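/- Let ρ_{E_AE_B} be a bipartite quantum state and N_{A→B} a quantum channel. Then the enhancement of the Holevo information by the assistance state is bounded by the discord of formation: χ_ρ(N) − χ(N) ≤ I_ρ(N) − χ(N) ≤ D_F(ρ_{E_AE_B}). -/

import Mathlib

open scoped Kronecker ComplexOrder
open Matrix

noncomputable section

namespace QIT

/-- Base-2 logarithm of a Hermitian matrix, via the spectral theorem
(junk value `0` on non-Hermitian inputs). -/
def matLog {ι : Type*} [Fintype ι] [DecidableEq ι] (ρ : Matrix ι ι ℂ) : Matrix ι ι ℂ :=
  if h : ρ.IsHermitian then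
    (h.eigenvectorUnitary : Matrix ι ι ℂ) *
      Matrix.diagonal (fun i => (Real.logb 2 (h.eigenvalues i) : ℂ)) *
      star (h.eigenvectorUnitary : Matrix ι ι ℂ)
  else 0

/-- Von Neumann entropy (base 2): `S(ρ) = -tr[ρ log ρ]`. -/
def entropy {ι : Type*} [Fintype ι] [DecidableEq ι] (ρ : Matrix ι ι ℂ) : ℝ :=
  -(ρ * matLog ρ).trace.re

/-- Quantum relative entropy (base 2): `D(ρ‖σ) = tr[ρ (log ρ - log σ)]`. -/
def relEnt {ι : Type*} [Fintype ι] [DecidableEq ι] (ρ σ : Matrix ι ι ℂ) : ℝ :=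
  (ρ * (matLog ρ - matLog σ)).trace.re

/-- A quantum state: positive semidefinite with unit trace. -/
def IsState {ι : Type*} [Fintype ι] (ρ : Matrix ι ι ℂ) : Prop :=
  ρ.PosSemidef ∧ ρ.trace = 1

/-- A pure state: a rank-one outer product `|v⟩⟨v|`. -/
def IsPure {ι : Type*} [Fintype ι] (ρ : Matrix ι ι ℂ) : Prop :=
  ∃ v : ι → ℂ, ρ = Matrix.vecMulVec v (star v)

/-- Partial trace over the second (right) tensor factor. -/
def ptrR {α β : Type*} [Fintype β] (ρ : Matrix (α × β) (α × β) ℂ) : Matrix α α ℂ :=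
  Matrix.of fun a a' => ∑ b, ρ (a, b) (a', b)

/-- Partial trace over the first (left) tensor factor. -/
def ptrL {α β : Type*} [Fintype α] (ρ : Matrix (α × β) (α × β) ℂ) : Matrix β β ℂ :=
  Matrix.of fun b b' => ∑ a, ρ (a, b) (a, b')

/-- Quantum mutual information `I(A:B) = S(ρ_A) + S(ρ_B) - S(ρ_{AB})` (entropy form). -/
def mutualInfoS {α β : Type*} [Fintype α] [DecidableEq α] [Fintype β] [DecidableEq β]
    (ρ : Matrix (α × β) (α × β) ℂ) : ℝ :=
  entropy (ptrR ρ) + entropy (ptrL ρ) - entropy ρ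

/-- Quantum mutual information `I(A:B) = D(ρ_{AB} ‖ ρ_A ⊗ ρ_B)` (relative-entropy form). -/
def mutualInfoD {α β : Type*} [Fintype α] [DecidableEq α] [Fintype β] [DecidableEq β]
    (ρ : Matrix (α × β) (α × β) ℂ) : ℝ :=
  relEnt ρ (ptrR ρ ⊗ₖ ptrL ρ)

/-- Tensoring a linear map on matrices with the identity on the left: `id_γ ⊗ L`. -/
def lTensor {α β : Type*} (γ : Type*) (L : Matrix α α ℂ →ₗ[ℂ] Matrix β β ℂ) :
    Matrix (γ × α) (γ × α) ℂ →ₗ[ℂ] Matrix (γ × β) (γ × β) ℂ where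
  toFun ρ := Matrix.of fun p q => L (Matrix.of fun a a' => ρ (p.1, a) (q.1, a')) p.2 q.2
  map_add' ρ σ := by
    ext p q
    have h : (Matrix.of fun a a' => ρ (p.1, a) (q.1, a') + σ (p.1, a) (q.1, a')) =
        (Matrix.of fun a a' => ρ (p.1, a) (q.1, a')) +
          Matrix.of fun a a' => σ (p.1, a) (q.1, a') := rfl
    simp only [Matrix.of_apply, Matrix.add_apply, h, map_add]
  map_smul' c ρ := by
    ext p q
    have h : (Matrix.of fun a a' => c * ρ (p.1, a) (q.1, a')) =
        c • Matrix.of fun a a' => ρ (p.1, a) (q.1, a') := rfl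
    simp only [Matrix.of_apply, Matrix.smul_apply, smul_eq_mul, RingHom.id_apply, h,
      _root_.map_smul]

/-- Tensoring a linear map on matrices with the identity on the right: `L ⊗ id_γ`. -/
def rTensor {α β : Type*} (γ : Type*) (L : Matrix α α ℂ →ₗ[ℂ] Matrix β β ℂ) :
    Matrix (α × γ) (α × γ) ℂ →ₗ[ℂ] Matrix (β × γ) (β × γ) ℂ where
  toFun ρ := Matrix.of fun p q => L (Matrix.of fun a a' => ρ (a, p.2) (a', q.2)) p.1 q.1
  map_add' ρ σ := by
    ext p q
    have h : (Matrix.of fun a a' => ρ (a, p.2) (a', q.2) + σ (a, p.2) (a', q.2)) =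
        (Matrix.of fun a a' => ρ (a, p.2) (a', q.2)) +
          Matrix.of fun a a' => σ (a, p.2) (a', q.2) := rfl
    simp only [Matrix.of_apply, Matrix.add_apply, h, map_add]
  map_smul' c ρ := by
    ext p q
    have h : (Matrix.of fun a a' => c * ρ (a, p.2) (a', q.2)) =
        c • Matrix.of fun a a' => ρ (a, p.2) (a', q.2) := rfl
    simp only [Matrix.of_apply, Matrix.smul_apply, smul_eq_mul, RingHom.id_apply, h,
      _root_.map_smul]

/-- A quantum channel: a completely positive trace-preserving linear map. -/
structure QChannel (α β : Type*) [Fintype α] [DecidableEq α] [Fintype β] [DecidableEq β] where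
  map : Matrix α α ℂ →ₗ[ℂ] Matrix β β ℂ
  cp : ∀ (n : ℕ) (ρ : Matrix (Fin n × α) (Fin n × α) ℂ), ρ.PosSemidef →
    ((lTensor (Fin n) map) ρ).PosSemidef
  tp : ∀ ρ : Matrix α α ℂ, (map ρ).trace = ρ.trace

/-- The classical-quantum state `Σ_x p(x) |x⟩⟨x| ⊗ σ^x`. -/
def cqState {ι γ : Type*} [DecidableEq ι] (p : ι → ℝ) (σ : ι → Matrix γ γ ℂ) :
    Matrix (ι × γ) (ι × γ) ℂ :=
  Matrix.of fun a b => if a.1 = b.1 then (p a.1 : ℂ) * σ a.1 a.2 b.2 else 0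

/-- A probability distribution on a finite alphabet. -/
def IsProbDist {ι : Type*} [Fintype ι] (p : ι → ℝ) : Prop :=
  (∀ x, 0 ≤ p x) ∧ ∑ x, p x = 1

section Assisted

variable {EA EB A B : Type*} [Fintype EA] [DecidableEq EA] [Fintype EB] [DecidableEq EB]
  [Fintype A] [DecidableEq A] [Fintype B] [DecidableEq B]

/-- The output state `(N ∘ E ⊗ id_{E_B})(ρ_{E_AE_B})` on `B ⊗ E_B`. -/
def assistedOut (N : QChannel A B) (E : QChannel EA A)
    (ρ : Matrix (EA × EB) (EA × EB) ℂ) : Matrix (B × EB) (B × EB) ℂ :=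
  rTensor EB (N.map ∘ₗ E.map) ρ

/-- The classical-quantum state
`ω_{XBE_B} = Σ_x p(x) |x⟩⟨x|_X ⊗ (N∘E^x ⊗ id_{E_B})(ρ_{E_AE_B})`. -/
def assistedCQ (N : QChannel A B) (ρ : Matrix (EA × EB) (EA × EB) ℂ)
    {n : ℕ} (p : Fin n → ℝ) (E : Fin n → QChannel EA A) :
    Matrix (Fin n × (B × EB)) (Fin n × (B × EB)) ℂ :=
  cqState p fun x => assistedOut N (E x) ρ

/-- Marginal of a state on `X ⊗ (B ⊗ E_B)` obtained by tracing out `B`. -/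
def margXE {X : Type*} (ω : Matrix (X × (B × EB)) (X × (B × EB)) ℂ) :
    Matrix (X × EB) (X × EB) ℂ :=
  Matrix.of fun p q => ∑ b, ω (p.1, (b, p.2)) (q.1, (b, q.2))

/-- `I(XE_B:B)` of a state on `X ⊗ (B ⊗ E_B)` (entropy form). -/
def infoXE_B {X : Type*} [Fintype X] [DecidableEq X]
    (ω : Matrix (X × (B × EB)) (X × (B × EB)) ℂ) : ℝ :=
  entropy (margXE ω) + entropy (ptrR (ptrL ω)) - entropy ω

/-- Regrouping `(X × E_B) × B ≃ X × (B × E_B)`. -/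
def regroupEquiv (X B EB : Type*) : (X × EB) × B ≃ X × (B × EB) :=
  (Equiv.prodAssoc X EB B).trans (Equiv.prodCongr (Equiv.refl X) (Equiv.prodComm EB B))

/-- `I(XE_B:B)` of a state on `X ⊗ (B ⊗ E_B)` (relative-entropy form). -/
def infoXE_B_D {X : Type*} [Fintype X] [DecidableEq X]
    (ω : Matrix (X × (B × EB)) (X × (B × EB)) ℂ) : ℝ :=
  mutualInfoD (ω.submatrix (regroupEquiv X B EB) (regroupEquiv X B EB))

/-- The `ρ`-assisted Holevo information `χ_ρ(N)` (entropy form of `I`). -/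
def assistedHolevoS (N : QChannel A B) (ρ : Matrix (EA × EB) (EA × EB) ℂ) : ℝ :=
  sSup { r | ∃ (n : ℕ) (p : Fin n → ℝ) (E : Fin n → QChannel EA A),
    IsProbDist p ∧ r = mutualInfoS (assistedCQ N ρ p E) }

/-- The `ρ`-assisted Holevo information `χ_ρ(N)` (relative-entropy form of `I`). -/
def assistedHolevoD (N : QChannel A B) (ρ : Matrix (EA × EB) (EA × EB) ℂ) : ℝ :=
  sSup { r | ∃ (n : ℕ) (p : Fin n → ℝ) (E : Fin n → QChannel EA A),
    IsProbDist p ∧ r = mutualInfoD (assistedCQ N ρ p E) }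

/-- The `ρ`-assisted mutual information `I_ρ(N)` (entropy form of `I`). -/
def assistedMutualS (N : QChannel A B) (ρ : Matrix (EA × EB) (EA × EB) ℂ) : ℝ :=
  sSup { r | ∃ (n : ℕ) (p : Fin n → ℝ) (E : Fin n → QChannel EA A),
    IsProbDist p ∧ r = infoXE_B (assistedCQ N ρ p E) }

/-- The `ρ`-assisted mutual information `I_ρ(N)` (relative-entropy form of `I`). -/
def assistedMutualD (N : QChannel A B) (ρ : Matrix (EA × EB) (EA × EB) ℂ) : ℝ :=
  sSup { r | ∃ (n : ℕ) (p : Fin n → ℝ) (E : Fin n → QChannel EA A),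
    IsProbDist p ∧ r = infoXE_B_D (assistedCQ N ρ p E) }

/-- The (unassisted) Holevo information `χ(N)` (entropy form of `I`). -/
def holevoS (N : QChannel A B) : ℝ :=
  sSup { r | ∃ (n : ℕ) (p : Fin n → ℝ) (σ : Fin n → Matrix A A ℂ),
    IsProbDist p ∧ (∀ x, IsState (σ x)) ∧
    r = mutualInfoS (cqState p fun x => N.map (σ x)) }

/-- The (unassisted) Holevo information `χ(N)` (relative-entropy form of `I`). -/
def holevoD (N : QChannel A B) : ℝ :=
  sSup { r | ∃ (n : ℕ) (p : Fin n → ℝ) (σ : Fin n → Matrix A A ℂ),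
    IsProbDist p ∧ (∀ x, IsState (σ x)) ∧
    r = mutualInfoD (cqState p fun x => N.map (σ x)) }

end Assisted

section ChannelMI

variable {A B : Type*} [Fintype A] [DecidableEq A] [Fintype B] [DecidableEq B]

/-- `φ_{AA'}` is a purification of `ρ_A`: a pure state whose marginal on the
first factor is `ρ_A`. -/
def IsPurification {A' : Type*} [Fintype A']
    (φ : Matrix (A × A') (A × A') ℂ) (ρ : Matrix A A ℂ) : Prop :=
  IsState φ ∧ IsPure φ ∧ ptrR φ = ρ

/-- The mutual information of the channel `N`,
`I(N) = max_{ρ_A} I(A':B)_{(N ⊗ id)(φ_{AA'})}` (purifying system `A' ≅ A`). -/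
def channelMI (N : QChannel A B) : ℝ :=
  sSup { r | ∃ (ρA : Matrix A A ℂ) (φ : Matrix (A × A) (A × A) ℂ),
    IsState ρA ∧ IsPurification φ ρA ∧ r = mutualInfoS (rTensor A N.map φ) }

end ChannelMI

section Coding

variable {EA EB A B : Type*} [Fintype EA] [DecidableEq EA] [Fintype EB] [DecidableEq EB]
  [Fintype A] [DecidableEq A] [Fintype B] [DecidableEq B]

/-- Product of `n` states on `B ⊗ E_B`, arranged on `B^n ⊗ E_B^n`. -/
def prodState {n : ℕ} (τ : Fin n → Matrix (B × EB) (B × EB) ℂ) :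
    Matrix ((Fin n → B) × (Fin n → EB)) ((Fin n → B) × (Fin n → EB)) ℂ :=
  Matrix.of fun p q => ∏ i, τ i (p.1 i, p.2 i) (q.1 i, q.2 i)

/-- Product of `n` states on `B ⊗ E_B`, with the `B^n` systems permuted by `π`. -/
def permProdState {n : ℕ} (π : Equiv.Perm (Fin n))
    (τ : Fin n → Matrix (B × EB) (B × EB) ℂ) :
    Matrix ((Fin n → B) × (Fin n → EB)) ((Fin n → B) × (Fin n → EB)) ℂ :=
  Matrix.of fun p q => ∏ i, τ i (p.1 (π i), p.2 i) (q.1 (π i), q.2 i)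

/-- Average decoding error probability of a code with message-dependent output
states `ω^m` and decoding POVM `{Λ_m}`. -/
def avgErr {n M : ℕ}
    (ω : Fin M → Matrix ((Fin n → B) × (Fin n → EB)) ((Fin n → B) × (Fin n → EB)) ℂ)
    (Λ : Fin M → Matrix ((Fin n → B) × (Fin n → EB)) ((Fin n → B) × (Fin n → EB)) ℂ) : ℝ :=
  (1 / (M : ℝ)) * ∑ m, ((1 - Λ m) * ω m).trace.re

/-- Existence of a blocklength-`n`, `M`-message, error-`≤ ε` code with product
encodings for the state-channel pair `(ρ, N)`. -/
def ProdCode (N : QChannel A B) (ρ : Matrix (EA × EB) (EA × EB) ℂ)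
    (n M : ℕ) (ε : ℝ) : Prop :=
  ∃ (Enc : Fin M → Fin n → QChannel EA A)
    (Λ : Fin M → Matrix ((Fin n → B) × (Fin n → EB)) ((Fin n → B) × (Fin n → EB)) ℂ),
    (∀ m, (Λ m).PosSemidef) ∧ (∑ m, Λ m) = 1 ∧
    avgErr (fun m => prodState fun i => assistedOut N (Enc m i) ρ) Λ ≤ ε

/-- Existence of a blocklength-`n`, `M`-message, error-`≤ ε` code with
semi-global encodings (local encodings followed by a global permutation). -/
def SemiGlobalCode (N : QChannel A B) (ρ : Matrix (EA × EB) (EA × EB) ℂ)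
    (n M : ℕ) (ε : ℝ) : Prop :=
  ∃ (Enc : Fin M → Fin n → QChannel EA A) (perm : Fin M → Equiv.Perm (Fin n))
    (Λ : Fin M → Matrix ((Fin n → B) × (Fin n → EB)) ((Fin n → B) × (Fin n → EB)) ℂ),
    (∀ m, (Λ m).PosSemidef) ∧ (∑ m, Λ m) = 1 ∧
    avgErr (fun m => permProdState (perm m) fun i => assistedOut N (Enc m i) ρ) Λ ≤ ε

/-- `R` is an `ε`-achievable rate with product encodings. -/
def ProdAchievable (N : QChannel A B) (ρ : Matrix (EA × EB) (EA × EB) ℂ)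
    (ε R : ℝ) : Prop :=
  ∀ δ : ℝ, 0 < δ → ∃ n₀ : ℕ, ∀ n ≥ n₀, ∃ M : ℕ,
    R - δ ≤ Real.logb 2 M / n ∧ ProdCode N ρ n M ε

/-- `R` is an `ε`-achievable rate with semi-global encodings. -/
def SemiGlobalAchievable (N : QChannel A B) (ρ : Matrix (EA × EB) (EA × EB) ℂ)
    (ε R : ℝ) : Prop :=
  ∀ δ : ℝ, 0 < δ → ∃ n₀ : ℕ, ∀ n ≥ n₀, ∃ M : ℕ,
    R - δ ≤ Real.logb 2 M / n ∧ SemiGlobalCode N ρ n M ε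

/-- The `ρ`-assisted `ε`-classical capacity with product encodings. -/
def prodCapacity (N : QChannel A B) (ρ : Matrix (EA × EB) (EA × EB) ℂ) (ε : ℝ) : ℝ :=
  sSup { R | ProdAchievable N ρ ε R }

/-- The `ρ`-assisted `ε`-classical capacity with semi-global encodings. -/
def semiGlobalCapacity (N : QChannel A B) (ρ : Matrix (EA × EB) (EA × EB) ℂ) (ε : ℝ) : ℝ :=
  sSup { R | SemiGlobalAchievable N ρ ε R }

end Coding

/-- The phase (Weyl) unitary `Z^u = Σ_z e^{2πiuz/d}|z⟩⟨z|` on `ℂ^d`. -/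
def Zmat (d : ℕ) (u : Fin d) : Matrix (Fin d) (Fin d) ℂ :=
  Matrix.diagonal fun z => Complex.exp (2 * Real.pi * Complex.I * u.1 * z.1 / d)

/-- Conjugation of a bipartite state by the phase unitary `Z^u ⊗ 1`. -/
def phaseConj {EB : Type*} [Fintype EB] [DecidableEq EB] (d : ℕ) (u : Fin d)
    (φ : Matrix (Fin d × EB) (Fin d × EB) ℂ) : Matrix (Fin d × EB) (Fin d × EB) ℂ :=
  (Zmat d u ⊗ₖ (1 : Matrix EB EB ℂ)) * φ * (Zmat d u ⊗ₖ (1 : Matrix EB EB ℂ))ᴴ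

/-- The (unnormalized) conditional operator `⟨z|φ|z⟩` on `E_B`. -/
def condState {EB : Type*} {d : ℕ} (φ : Matrix (Fin d × EB) (Fin d × EB) ℂ)
    (z : Fin d) : Matrix EB EB ℂ :=
  Matrix.of fun e e' => φ (z, e) (z, e')

/-- Shannon entropy (base 2) of a probability vector. -/
def shannonEnt {ι : Type*} [Fintype ι] (p : ι → ℝ) : ℝ :=
  -∑ i, p i * Real.logb 2 (p i)

/-- Binary entropy (base 2). -/
def binEnt (p : ℝ) : ℝ :=
  -(p * Real.logb 2 p) - (1 - p) * Real.logb 2 (1 - p)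

/-- Kullback-Leibler divergence (base 2) between probability vectors. -/
def klDiv {ι : Type*} [Fintype ι] (p q : ι → ℝ) : ℝ :=
  ∑ i, p i * Real.logb 2 (p i / q i)

section Discord

variable {α β : Type*} [Fintype α] [DecidableEq α] [Fintype β] [DecidableEq β]

/-- The (unnormalized) operator `⟨v|ρ|v⟩` on `α`, sandwiching on the second factor. -/
def sandwichR (ρ : Matrix (α × β) (α × β) ℂ) (v : β → ℂ) : Matrix α α ℂ :=
  Matrix.of fun a a' => ∑ b, ∑ b', star (v b) * ρ (a, b) (a', b') * v b'

/-- The relative entropy of discord `D_R(ρ_{AB})`. -/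
def relEntDiscord (ρ : Matrix (α × β) (α × β) ℂ) : ℝ :=
  sInf { r | ∃ V ∈ Matrix.unitaryGroup β ℂ, r = relEnt ρ
    (∑ y : β, sandwichR ρ (fun b => V b y) ⊗ₖ
      Matrix.vecMulVec (fun b => V b y) (star fun b => V b y)) }

/-- The discord of formation `D_F(ρ_{AB})`. -/
def discordOfFormation (ρ : Matrix (α × β) (α × β) ℂ) : ℝ :=
  sInf { r | ∃ (n : ℕ) (p : Fin n → ℝ) (τ : Fin n → Matrix (α × β) (α × β) ℂ),
    IsProbDist p ∧ (∀ x, IsState (τ x)) ∧ (ρ = ∑ x, (p x : ℂ) • τ x) ∧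
    r = ∑ x, p x * relEntDiscord (τ x) }

end Discord

section Diagonalization

variable {ι : Type*} [Fintype ι] [DecidableEq ι]

/-- `σ = U diag(d) Uᴴ` with `U` unitary and `d` real. -/
structure Diag (σ U : Matrix ι ι ℂ) (d : ι → ℝ) : Prop where
  unit : Uᴴ * U = 1
  eq : σ = U * diagonal (fun j => (d j : ℂ)) * Uᴴ

/-- The diagonal of `ρ` in the orthonormal basis given by the columns of `V`. -/
def dg (ρ V : Matrix ι ι ℂ) (j : ι) : ℝ := ((Vᴴ * ρ * V) j j).re

/-- The entropy function `-x log₂ x`. -/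
def eta (x : ℝ) : ℝ := -(x * Real.logb 2 x)

theorem Diag.unit' {σ U : Matrix ι ι ℂ} {d : ι → ℝ} (h : Diag σ U d) : U * Uᴴ = 1 :=
  mul_eq_one_comm.1 h.unit

theorem Diag.conj {σ U : Matrix ι ι ℂ} {d : ι → ℝ} (h : Diag σ U d) :
    Uᴴ * σ * U = diagonal (fun j => (d j : ℂ)) := by
  rw [h.eq]
  calc Uᴴ * (U * diagonal (fun j => (d j : ℂ)) * Uᴴ) * U
      = (Uᴴ * U) * diagonal (fun j => (d j : ℂ)) * (Uᴴ * U) := by simp only [Matrix.mul_assoc]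
    _ = _ := by rw [h.unit]; simp

theorem Diag.of_conj {σ U : Matrix ι ι ℂ} {d : ι → ℝ} (hU : Uᴴ * U = 1)
    (h : Uᴴ * σ * U = diagonal (fun j => (d j : ℂ))) : Diag σ U d := by
  refine ⟨hU, ?_⟩
  have hU' : U * Uᴴ = 1 := mul_eq_one_comm.1 hU
  rw [← h]
  calc σ = (U * Uᴴ) * σ * (U * Uᴴ) := by rw [hU']; simp
    _ = _ := by simp only [Matrix.mul_assoc]

theorem Diag.of_mul {σ U : Matrix ι ι ℂ} {d : ι → ℝ} (hU : Uᴴ * U = 1)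
    (h : σ * U = U * diagonal (fun j => (d j : ℂ))) : Diag σ U d :=
  .of_conj hU (by rw [Matrix.mul_assoc, h, ← Matrix.mul_assoc, hU, Matrix.one_mul])

theorem diag_eigen {σ : Matrix ι ι ℂ} (h : σ.IsHermitian) :
    Diag σ (h.eigenvectorUnitary : Matrix ι ι ℂ) h.eigenvalues := by
  refine ⟨Unitary.coe_star_mul_self h.eigenvectorUnitary, ?_⟩
  conv_lhs => rw [h.spectral_theorem]
  simp [Unitary.conjStarAlgAut_apply, Function.comp_def, star_eq_conjTranspose]

theorem exists_diag {σ : Matrix ι ι ℂ} (h : σ.IsHermitian) : ∃ U d, Diag σ U d :=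
  ⟨_, _, diag_eigen h⟩

theorem Diag.isHermitian {σ U : Matrix ι ι ℂ} {d : ι → ℝ} (h : Diag σ U d) :
    σ.IsHermitian := by
  rw [h.eq]
  apply isHermitian_mul_mul_conjTranspose
  exact isHermitian_diagonal_of_self_adjoint _ (by ext; simp)

theorem Diag.map_eq {σ U V : Matrix ι ι ℂ} {d e : ι → ℝ} (h : Diag σ U d) (h' : Diag σ V e)
    (f : ℝ → ℝ) : U * diagonal (fun j => (f (d j) : ℂ)) * Uᴴ =
      V * diagonal (fun j => (f (e j) : ℂ)) * Vᴴ := by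
  have hcomm : (Vᴴ * U) * diagonal (fun j => (d j : ℂ)) =
      diagonal (fun j => (e j : ℂ)) * (Vᴴ * U) := by
    rw [← h.conj, ← h'.conj]
    calc Vᴴ * U * (Uᴴ * σ * U) = Vᴴ * (U * Uᴴ) * σ * U := by simp only [Matrix.mul_assoc]
      _ = Vᴴ * σ * (V * Vᴴ) * U := by rw [h.unit', h'.unit']; simp
      _ = _ := by simp only [Matrix.mul_assoc]
  have hf : (Vᴴ * U) * diagonal (fun j => (f (d j) : ℂ)) =
      diagonal (fun j => (f (e j) : ℂ)) * (Vᴴ * U) := by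
    ext i j
    have := congrFun (congrFun hcomm i) j
    rw [mul_diagonal, diagonal_mul] at this ⊢
    by_cases hw : (Vᴴ * U) i j = 0
    · simp [hw]
    · have hde : (d j : ℂ) = e i := by
        apply mul_left_cancel₀ hw; rw [this, mul_comm]
      have : d j = e i := by exact_mod_cast hde
      rw [this, mul_comm]
  calc U * diagonal (fun j => (f (d j) : ℂ)) * Uᴴ
      = (V * Vᴴ) * U * diagonal (fun j => (f (d j) : ℂ)) * Uᴴ := by rw [h'.unit']; simp
    _ = V * ((Vᴴ * U) * diagonal (fun j => (f (d j) : ℂ))) * Uᴴ := by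
        simp only [Matrix.mul_assoc]
    _ = V * diagonal (fun j => (f (e j) : ℂ)) * Vᴴ * (U * Uᴴ) := by
        rw [hf]; simp only [Matrix.mul_assoc]
    _ = _ := by rw [h.unit', Matrix.mul_one]

theorem Diag.matLog_eq {σ U : Matrix ι ι ℂ} {d : ι → ℝ} (h : Diag σ U d) :
    matLog σ = U * diagonal (fun j => (Real.logb 2 (d j) : ℂ)) * Uᴴ := by
  rw [matLog, dif_pos h.isHermitian]
  exact (diag_eigen h.isHermitian).map_eq h _

theorem Diag.trace_mul_matLog {σ U : Matrix ι ι ℂ} {d : ι → ℝ} (h : Diag σ U d)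
    (ρ : Matrix ι ι ℂ) :
    (ρ * matLog σ).trace.re = ∑ j, dg ρ U j * Real.logb 2 (d j) := by
  rw [h.matLog_eq]
  have : (ρ * (U * diagonal (fun j => (Real.logb 2 (d j) : ℂ)) * Uᴴ)).trace =
      ((Uᴴ * ρ * U) * diagonal (fun j => (Real.logb 2 (d j) : ℂ))).trace := by
    rw [← Matrix.mul_assoc, trace_mul_comm]
    simp only [Matrix.mul_assoc]
  rw [this, trace, Complex.re_sum]
  refine Finset.sum_congr rfl fun j _ => ?_
  rw [diag_apply, mul_diagonal, Complex.re_mul_ofReal, dg]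

theorem Diag.dg_self {σ U : Matrix ι ι ℂ} {d : ι → ℝ} (h : Diag σ U d) (j : ι) :
    dg σ U j = d j := by
  rw [dg, h.conj, diagonal_apply_eq, Complex.ofReal_re]

theorem Diag.entropy_eq {σ U : Matrix ι ι ℂ} {d : ι → ℝ} (h : Diag σ U d) :
    entropy σ = ∑ j, eta (d j) := by
  rw [entropy, h.trace_mul_matLog, ← Finset.sum_neg_distrib]
  simp [h.dg_self, eta]

theorem Diag.trace_eq {σ U : Matrix ι ι ℂ} {d : ι → ℝ} (h : Diag σ U d) :
    σ.trace = ∑ j, (d j : ℂ) := by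
  rw [h.eq, trace_mul_comm, ← Matrix.mul_assoc, h.unit, Matrix.one_mul, trace_diagonal]

theorem Diag.trace_re {σ U : Matrix ι ι ℂ} {d : ι → ℝ} (h : Diag σ U d) :
    σ.trace.re = ∑ j, d j := by
  rw [h.trace_eq]; simp

theorem dg_nonneg {ρ : Matrix ι ι ℂ} (h : ρ.PosSemidef) (V : Matrix ι ι ℂ) (j : ι) :
    0 ≤ dg ρ V j :=
  (Complex.nonneg_iff.1 (h.conjTranspose_mul_mul_same V).diag_nonneg).1

theorem Diag.nonneg {σ U : Matrix ι ι ℂ} {d : ι → ℝ} (h : Diag σ U d) (hσ : σ.PosSemidef)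
    (j : ι) : 0 ≤ d j := h.dg_self j ▸ dg_nonneg hσ U j

theorem sum_dg (ρ : Matrix ι ι ℂ) {V : Matrix ι ι ℂ} (hV : Vᴴ * V = 1) :
    ∑ j, dg ρ V j = ρ.trace.re := by
  have : ρ.trace = (Vᴴ * ρ * V).trace := by
    rw [trace_mul_comm, ← Matrix.mul_assoc, mul_eq_one_comm.1 hV, Matrix.one_mul]
  rw [this, trace, Complex.re_sum]; rfl

theorem relEnt_eq_sub {ρ σ V : Matrix ι ι ℂ} {μ : ι → ℝ} (h : Diag σ V μ) :
    relEnt ρ σ = -entropy ρ - ∑ j, dg ρ V j * Real.logb 2 (μ j) := by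
  rw [relEnt, Matrix.mul_sub, trace_sub, Complex.sub_re, h.trace_mul_matLog, entropy, neg_neg]

/-- Squared overlaps of two orthonormal bases. -/
def ovl (U V : Matrix ι ι ℂ) (i j : ι) : ℝ := Complex.normSq ((Uᴴ * V) i j)

theorem ovl_nonneg (U V : Matrix ι ι ℂ) (i j : ι) : 0 ≤ ovl U V i j := Complex.normSq_nonneg _

theorem Diag.dg_eq {ρ U : Matrix ι ι ℂ} {l : ι → ℝ} (h : Diag ρ U l) (V : Matrix ι ι ℂ) (j : ι) :
    dg ρ V j = ∑ i, ovl U V i j * l i := by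
  have : Vᴴ * ρ * V = (Uᴴ * V)ᴴ * (diagonal (fun j => (l j : ℂ)) * (Uᴴ * V)) := by
    rw [h.eq]; simp only [Matrix.mul_assoc, conjTranspose_mul, conjTranspose_conjTranspose]
  rw [dg, this, mul_apply, Complex.re_sum]
  refine Finset.sum_congr rfl fun i _ => ?_
  rw [diagonal_mul, conjTranspose_apply, ovl, mul_left_comm, mul_comm, Complex.re_mul_ofReal,
    Complex.star_def, Complex.normSq_eq_conj_mul_self.symm, Complex.ofReal_re]

theorem sum_ovl_right {U V : Matrix ι ι ℂ} (hU : Uᴴ * U = 1) (hV : Vᴴ * V = 1) (i : ι) :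
    ∑ j, ovl U V i j = 1 := by
  have h : (Uᴴ * V) * (Uᴴ * V)ᴴ = 1 := by
    calc (Uᴴ * V) * (Uᴴ * V)ᴴ = Uᴴ * (V * Vᴴ) * U := by
          simp only [Matrix.mul_assoc, conjTranspose_mul, conjTranspose_conjTranspose]
      _ = 1 := by rw [mul_eq_one_comm.1 hV, Matrix.mul_one, hU]
  have h2 := congrArg Complex.re (congrFun (congrFun h i) i)
  rw [mul_apply, Complex.re_sum, one_apply_eq, Complex.one_re] at h2
  rw [← h2]
  refine Finset.sum_congr rfl fun j _ => ?_
  rw [conjTranspose_apply, Complex.star_def, Complex.mul_conj, Complex.ofReal_re, ovl]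

theorem ovl_comm (U V : Matrix ι ι ℂ) (i j : ι) : ovl U V i j = ovl V U j i := by
  have : (Uᴴ * V) i j = star ((Vᴴ * U) j i) := by
    rw [← conjTranspose_apply, conjTranspose_mul, conjTranspose_conjTranspose]
  rw [ovl, ovl, this, Complex.star_def, Complex.normSq_conj]

theorem sum_ovl_left {U V : Matrix ι ι ℂ} (hU : Uᴴ * U = 1) (hV : Vᴴ * V = 1) (j : ι) :
    ∑ i, ovl U V i j = 1 := by
  simp_rw [ovl_comm U V]; exact sum_ovl_right hV hU j

theorem relEnt_eq_sum {ρ σ U V : Matrix ι ι ℂ} {l μ : ι → ℝ} (hρ : Diag ρ U l)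
    (hσ : Diag σ V μ) : relEnt ρ σ =
      ∑ i, ∑ j, ovl U V i j * l i * (Real.logb 2 (l i) - Real.logb 2 (μ j)) := by
  rw [relEnt_eq_sub hσ, hρ.entropy_eq]
  simp_rw [mul_sub, Finset.sum_sub_distrib, hρ.dg_eq]
  congr 1
  · rw [← Finset.sum_neg_distrib]
    refine Finset.sum_congr rfl fun i _ => ?_
    simp_rw [mul_assoc]
    rw [← Finset.sum_mul, sum_ovl_right hρ.unit hσ.unit, eta]; ring
  · rw [Finset.sum_comm]
    simp_rw [Finset.sum_mul]

/-- The support of `ρ` is contained in that of `σ`, phrased in an eigenbasis of `σ`. -/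
def SuppLE (ρ σ : Matrix ι ι ℂ) : Prop :=
  ∃ V μ, Diag σ V μ ∧ ∀ j, μ j = 0 → dg ρ V j = 0

theorem Diag.ovl_mul_eq_zero {ρ U V : Matrix ι ι ℂ} {l : ι → ℝ} (hρ : Diag ρ U l)
    (hp : ρ.PosSemidef) {j : ι} (h : dg ρ V j = 0) (i : ι) : ovl U V i j * l i = 0 := by
  rw [hρ.dg_eq] at h
  exact (Finset.sum_eq_zero_iff_of_nonneg
    (fun i _ => mul_nonneg (ovl_nonneg _ _ _ _) (hρ.nonneg hp i))).1 h i (Finset.mem_univ _)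

/-- Klein's inequality. -/
theorem relEnt_nonneg {ρ σ : Matrix ι ι ℂ} (hρ : ρ.PosSemidef) (hσ : σ.PosSemidef)
    (hs : SuppLE ρ σ) (ht : σ.trace.re ≤ ρ.trace.re) : 0 ≤ relEnt ρ σ := by
  obtain ⟨V, μ, hV, h0⟩ := hs
  obtain ⟨U, l, hU⟩ := exists_diag hρ.isHermitian
  rw [relEnt_eq_sum hU hV]
  have key : ∀ i j, ovl U V i j * (l i - μ j) / Real.log 2 ≤
      ovl U V i j * l i * (Real.logb 2 (l i) - Real.logb 2 (μ j)) := by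
    intro i j
    have hl2 : 0 < Real.log 2 := Real.log_pos one_lt_two
    rw [Real.logb, Real.logb, ← sub_div, ← mul_div_assoc]
    refine div_le_div_of_nonneg_right ?_ hl2.le
    have ho := ovl_nonneg U V i j
    rcases (hV.nonneg hσ j).eq_or_lt with hm | hm
    · have := hU.ovl_mul_eq_zero hρ (h0 j hm.symm) i
      rw [this, mul_sub, this, ← hm]; simp
    rcases (hU.nonneg hρ i).eq_or_lt with hl | hl
    · rw [← hl]; simp; positivity
    rw [mul_assoc]
    refine mul_le_mul_of_nonneg_left ?_ ho
    have := Real.log_le_sub_one_of_pos (div_pos hm hl)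
    rw [Real.log_div hm.ne' hl.ne'] at this
    have h3 := mul_le_mul_of_nonneg_left this hl.le
    have h4 : l i * (μ j / l i - 1) = μ j - l i := by field_simp
    rw [h4] at h3
    linarith
  refine le_trans ?_ (Finset.sum_le_sum fun i _ => Finset.sum_le_sum fun j _ => key i j)
  simp_rw [← Finset.sum_div]
  refine div_nonneg ?_ (Real.log_pos one_lt_two).le
  simp_rw [mul_sub, Finset.sum_sub_distrib]
  rw [Finset.sum_comm (f := fun i j => ovl U V i j * μ j)]
  simp_rw [← Finset.sum_mul, sum_ovl_left hU.unit hV.unit, sum_ovl_right hU.unit hV.unit, one_mul]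
  rw [← hU.trace_re, ← hV.trace_re]
  linarith

end Diagonalization

section Monotonicity

open Filter Topology in
theorem sum_mul_log_le_of_pos {I J : Type*} [Fintype I] [Fintype J] {c t : I → ℝ} {c' t' : J → ℝ}
    (ht : ∀ i, 0 < t i) (ht' : ∀ j, 0 < t' j)
    (hs : ∀ s : ℝ, 0 < s → ∑ i, c i / (t i + s) ≤ ∑ j, c' j / (t' j + s))
    (hc : ∑ i, c i = ∑ j, c' j) :
    ∑ j, c' j * Real.log (t' j) ≤ ∑ i, c i * Real.log (t i) := by
  set G : ℝ → ℝ := fun s => ∑ j, c' j * Real.log (s + t' j) - ∑ i, c i * Real.log (s + t i) with hG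
  have hderiv : ∀ s : ℝ, 0 ≤ s →
      HasDerivAt G (∑ j, c' j * (1 / (s + t' j)) - ∑ i, c i * (1 / (s + t i))) s := by
    intro s h0
    refine HasDerivAt.sub (HasDerivAt.fun_sum fun j _ => ?_) (HasDerivAt.fun_sum fun i _ => ?_)
    · exact (((hasDerivAt_id s).add_const (t' j)).log
        (by have := ht' j; simp only [id]; positivity)).const_mul (c' j)
    · exact (((hasDerivAt_id s).add_const (t i)).log
        (by have := ht i; simp only [id]; positivity)).const_mul (c i)
  have hmono : MonotoneOn G (Set.Ici 0) := by
    refine monotoneOn_of_deriv_nonneg (convex_Ici 0)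
      (fun s h0 => (hderiv s h0).continuousAt.continuousWithinAt)
      (fun s h0 => ?_) (fun s h0 => ?_)
    · rw [interior_Ici] at h0
      exact (hderiv s (le_of_lt h0)).differentiableAt.differentiableWithinAt
    · rw [interior_Ici] at h0
      rw [(hderiv s (le_of_lt h0)).deriv, sub_nonneg]
      simpa [div_eq_mul_inv, add_comm] using hs s h0
  have hlim : Tendsto G atTop (𝓝 0) := by
    have h1 : G = fun s => ∑ j, c' j * (Real.log (s + t' j) - Real.log s) -
        ∑ i, c i * (Real.log (s + t i) - Real.log s) := by
      funext s
      simp only [hG, mul_sub, Finset.sum_sub_distrib, ← Finset.sum_mul, hc]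
      ring
    rw [h1]
    have h2 : (0 : ℝ) = ∑ j : J, c' j * 0 - ∑ i : I, c i * 0 := by simp
    rw [h2]
    exact (tendsto_finsetSum _ fun j _ =>
      (Real.tendsto_log_comp_add_sub_log (t' j)).const_mul _).sub
      (tendsto_finsetSum _ fun i _ => (Real.tendsto_log_comp_add_sub_log (t i)).const_mul _)
  have h0 : G 0 ≤ 0 := by
    refine ge_of_tendsto hlim ?_
    filter_upwards [eventually_ge_atTop 0] with s h
    exact hmono (Set.mem_Ici.2 le_rfl) h h
  simpa [hG, sub_nonpos] using h0

/-- Comparison of logarithmic sums from comparison of the resolvent sums. -/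
theorem sum_mul_log_le {I J : Type*} [Fintype I] [Fintype J] {c t : I → ℝ} {c' t' : J → ℝ}
    (ht : ∀ i, c i ≠ 0 → 0 < t i) (ht' : ∀ j, c' j ≠ 0 → 0 < t' j)
    (hs : ∀ s : ℝ, 0 < s → ∑ i, c i / (t i + s) ≤ ∑ j, c' j / (t' j + s))
    (hc : ∑ i, c i = ∑ j, c' j) :
    ∑ j, c' j * Real.log (t' j) ≤ ∑ i, c i * Real.log (t i) := by
  classical
  have key := sum_mul_log_le_of_pos (c := c) (c' := c')
    (t := fun i => if c i = 0 then 1 else t i) (t' := fun j => if c' j = 0 then 1 else t' j)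
    (fun i => by split_ifs with h; exacts [one_pos, ht i h])
    (fun j => by split_ifs with h; exacts [one_pos, ht' j h]) (fun s h => ?_) hc
  · convert key using 2 with j _ i _
    · split_ifs with h <;> simp [h]
    · split_ifs with h <;> simp [h]
  · convert hs s h using 2 with i _ j _
    · split_ifs with h <;> simp [h]
    · split_ifs with h <;> simp [h]

variable {ι : Type*} [Fintype ι] [DecidableEq ι]

/-- The functional whose supremum over `X` is the resolvent form of the relative entropy. -/
def resForm (s : ℝ) (X ρ σ : Matrix ι ι ℂ) : ℝ :=
  2 * (X * ρ).trace.re - (X * σ * Xᴴ).trace.re - s * (Xᴴ * ρ * X).trace.re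

theorem trace_mul_diagonal_mul (Z : Matrix ι ι ℂ) (d : ι → ℝ) :
    (Z * diagonal (fun j => (d j : ℂ)) * Zᴴ).trace.re =
      ∑ i, ∑ j, Complex.normSq (Z i j) * d j := by
  rw [trace, Complex.re_sum]
  refine Finset.sum_congr rfl fun i _ => ?_
  rw [diag_apply, mul_apply, Complex.re_sum]
  refine Finset.sum_congr rfl fun j _ => ?_
  rw [mul_diagonal, conjTranspose_apply, mul_right_comm, Complex.re_mul_ofReal,
    Complex.star_def, Complex.mul_conj, Complex.ofReal_re]

theorem resForm_eq {ρ σ U V : Matrix ι ι ℂ} {l μ : ι → ℝ} (hρ : Diag ρ U l) (hσ : Diag σ V μ)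
    (s : ℝ) (Z : Matrix ι ι ℂ) : resForm s (U * Z * Vᴴ) ρ σ =
      ∑ i, ∑ j, (2 * (Z i j * star ((Uᴴ * V) i j)).re * l i -
        Complex.normSq (Z i j) * (μ j + s * l i)) := by
  have h1 : (U * Z * Vᴴ * ρ).trace.re = ∑ i, ∑ j, (Z i j * star ((Uᴴ * V) i j)).re * l i := by
    have : (U * Z * Vᴴ * ρ).trace =
        (Z * (Uᴴ * V)ᴴ * diagonal (fun j => (l j : ℂ))).trace := by
      calc (U * Z * Vᴴ * ρ).trace = (U * (Z * Vᴴ * ρ)).trace := by simp only [Matrix.mul_assoc]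
        _ = (Z * Vᴴ * (U * Uᴴ) * ρ * U).trace := by
          rw [trace_mul_comm, hρ.unit']; simp only [Matrix.mul_assoc, Matrix.one_mul]
        _ = (Z * (Vᴴ * U) * (Uᴴ * ρ * U)).trace := by simp only [Matrix.mul_assoc]
        _ = _ := by rw [hρ.conj, conjTranspose_mul, conjTranspose_conjTranspose]
    rw [this, trace, Complex.re_sum]
    refine Finset.sum_congr rfl fun i _ => ?_
    rw [diag_apply, mul_diagonal, Complex.re_mul_ofReal, mul_apply, Complex.re_sum,
      Finset.sum_mul]
    rfl
  have h2 : (U * Z * Vᴴ * σ * (U * Z * Vᴴ)ᴴ).trace.re =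
      ∑ i, ∑ j, Complex.normSq (Z i j) * μ j := by
    rw [← trace_mul_diagonal_mul, ← hσ.conj]
    congr 1
    simp only [conjTranspose_mul, conjTranspose_conjTranspose]
    calc (U * Z * Vᴴ * σ * (V * (Zᴴ * Uᴴ))).trace
        = (U * (Z * Vᴴ * σ * V * Zᴴ * Uᴴ)).trace := by simp only [Matrix.mul_assoc]
      _ = (Z * (Vᴴ * σ * V) * Zᴴ * (Uᴴ * U)).trace := by
        rw [trace_mul_comm]; simp only [Matrix.mul_assoc]
      _ = _ := by rw [hρ.unit, Matrix.mul_one]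
  have h3 : ((U * Z * Vᴴ)ᴴ * ρ * (U * Z * Vᴴ)).trace.re =
      ∑ i, ∑ j, Complex.normSq (Z i j) * l i := by
    have : ((U * Z * Vᴴ)ᴴ * ρ * (U * Z * Vᴴ)).trace.re =
        (Zᴴ * diagonal (fun j => (l j : ℂ)) * Zᴴᴴ).trace.re := by
      rw [← hρ.conj]
      congr 1
      simp only [conjTranspose_mul, conjTranspose_conjTranspose]
      calc (V * (Zᴴ * Uᴴ) * ρ * (U * Z * Vᴴ)).trace
          = (V * (Zᴴ * Uᴴ * ρ * U * Z * Vᴴ)).trace := by simp only [Matrix.mul_assoc]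
        _ = (Zᴴ * (Uᴴ * ρ * U) * Z * (Vᴴ * V)).trace := by
          rw [trace_mul_comm]; simp only [Matrix.mul_assoc]
        _ = _ := by rw [hσ.unit, Matrix.mul_one]
    rw [this, trace_mul_diagonal_mul, Finset.sum_comm]
    simp [conjTranspose_apply, Complex.normSq_conj]
  rw [resForm, h1, h2, h3]
  simp_rw [Finset.sum_sub_distrib, mul_add, Finset.sum_add_distrib, Finset.mul_sum]
  rw [← sub_sub]
  congr 2
  · simp_rw [mul_assoc]
  · simp_rw [mul_left_comm]

theorem quad_le (z w : ℂ) {l D : ℝ} (hD : 0 < D) :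
    2 * (z * star w).re * l - Complex.normSq z * D ≤ Complex.normSq w * l * (l / D) := by
  rw [← mul_div_assoc, le_div_iff₀ hD]
  simp only [Complex.normSq_apply, Complex.mul_re, Complex.star_def, Complex.conj_re,
    Complex.conj_im]
  nlinarith [sq_nonneg (z.re * D - l * w.re), sq_nonneg (z.im * D - l * w.im)]

theorem quad_eq (w : ℂ) {l D : ℝ} (hD : 0 < D) :
    2 * (((l / D : ℝ) : ℂ) * w * star w).re * l - Complex.normSq (((l / D : ℝ) : ℂ) * w) * D =
      Complex.normSq w * l * (l / D) := by
  rw [mul_assoc (_ : ℂ), Complex.star_def, Complex.mul_conj, ← Complex.ofReal_mul, Complex.ofReal_re,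
    Complex.normSq_mul, Complex.normSq_ofReal]
  field_simp
  ring

theorem relEnt_repr {ρ σ : Matrix ι ι ℂ} (hρ : ρ.PosSemidef) (hσ : σ.PosSemidef)
    (hs : SuppLE ρ σ) : ∃ c t : ι × ι → ℝ, (∀ p, c p ≠ 0 → 0 < t p) ∧
      ∑ p, c p = ρ.trace.re ∧ relEnt ρ σ = -(∑ p, c p * Real.log (t p)) / Real.log 2 ∧
      (∀ s, 0 < s → ∀ X, resForm s X ρ σ ≤ ∑ p, c p / (t p + s)) ∧
      ∀ s, 0 < s → ∃ X, resForm s X ρ σ = ∑ p, c p / (t p + s) := by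
  obtain ⟨V, μ, hV, h0⟩ := hs
  obtain ⟨U, l, hU⟩ := exists_diag hρ.isHermitian
  have hl := hU.nonneg hρ
  have hm := hV.nonneg hσ
  have hsupp : ∀ i j, ovl U V i j * l i ≠ 0 → 0 < l i ∧ 0 < μ j := by
    intro i j h
    refine ⟨(hl i).lt_of_ne fun h' => h (by rw [← h', mul_zero]), (hm j).lt_of_ne fun h' => h ?_⟩
    exact hU.ovl_mul_eq_zero hρ (h0 j h'.symm) i
  have hterm : ∀ s, 0 < s → ∀ i j, ovl U V i j * l i / (μ j / l i + s) =
      ovl U V i j * l i * (l i / (μ j + s * l i)) := by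
    intro s _ i j
    by_cases h : ovl U V i j * l i = 0
    · simp [h]
    · obtain ⟨h1, h2⟩ := hsupp i j h
      field_simp
  refine ⟨fun p => ovl U V p.1 p.2 * l p.1, fun p => μ p.2 / l p.1, fun p hp => ?_, ?_, ?_, ?_, ?_⟩
  · obtain ⟨h1, h2⟩ := hsupp _ _ hp
    positivity
  · rw [Fintype.sum_prod_type]
    simp_rw [← Finset.sum_mul, sum_ovl_right hU.unit hV.unit, one_mul, hU.trace_re]
  · rw [relEnt_eq_sum hU hV, Fintype.sum_prod_type, neg_div, Finset.sum_div,
      ← Finset.sum_neg_distrib]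
    refine Finset.sum_congr rfl fun i _ => ?_
    rw [Finset.sum_div, ← Finset.sum_neg_distrib]
    refine Finset.sum_congr rfl fun j _ => ?_
    by_cases h : ovl U V i j * l i = 0
    · simp [h]
    · obtain ⟨h1, h2⟩ := hsupp i j h
      simp only [Real.log_div h2.ne' h1.ne', Real.logb]
      ring
  · intro s hs X
    have hX : X = U * (Uᴴ * X * V) * Vᴴ := by
      calc X = (U * Uᴴ) * X * (V * Vᴴ) := by rw [hU.unit', hV.unit']; simp
        _ = _ := by simp only [Matrix.mul_assoc]
    rw [hX, resForm_eq hU hV, Fintype.sum_prod_type]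
    refine Finset.sum_le_sum fun i _ => Finset.sum_le_sum fun j _ => ?_
    rw [hterm s hs]
    rcases (add_nonneg (hm j) (mul_nonneg hs.le (hl i))).eq_or_lt with hD | hD
    · have hl0 : l i = 0 := by
        have := mul_nonneg hs.le (hl i)
        have h3 : s * l i = 0 := by linarith [hm j]
        exact (mul_eq_zero.1 h3).resolve_left hs.ne'
      rw [← hD, hl0]; simp
    · exact quad_le _ _ hD
  · intro s hs
    refine ⟨U * (of fun i j => ((l i / (μ j + s * l i) : ℝ) : ℂ) * (Uᴴ * V) i j) * Vᴴ, ?_⟩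
    rw [resForm_eq hU hV, Fintype.sum_prod_type]
    refine Finset.sum_congr rfl fun i _ => Finset.sum_congr rfl fun j _ => ?_
    rw [hterm s hs, of_apply]
    rcases (add_nonneg (hm j) (mul_nonneg hs.le (hl i))).eq_or_lt with hD | hD
    · rw [← hD]; simp
    · exact quad_eq _ hD

/-- Comparison of relative entropies from comparison of the resolvent functionals. -/
theorem relEnt_le_sum {κ ι' : Type*} [Fintype κ] [Fintype ι'] [DecidableEq ι']
    {q : κ → ℝ} (hq : ∀ k, 0 ≤ q k) {ρ σ : κ → Matrix ι ι ℂ} {ρ' σ' : Matrix ι' ι' ℂ}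
    (hρ : ∀ k, (ρ k).PosSemidef) (hσ : ∀ k, (σ k).PosSemidef) (hs : ∀ k, SuppLE (ρ k) (σ k))
    (hρ' : ρ'.PosSemidef) (hσ' : σ'.PosSemidef) (hs' : SuppLE ρ' σ')
    (ht : ρ'.trace.re = ∑ k, q k * (ρ k).trace.re)
    (hres : ∀ s, 0 < s → ∀ X', ∃ X : κ → Matrix ι ι ℂ,
      resForm s X' ρ' σ' ≤ ∑ k, q k * resForm s (X k) (ρ k) (σ k)) :
    relEnt ρ' σ' ≤ ∑ k, q k * relEnt (ρ k) (σ k) := by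
  choose c t hct hsum hrel hle hex using fun k => relEnt_repr (hρ k) (hσ k) (hs k)
  obtain ⟨c', t', hct', hsum', hrel', hle', hex'⟩ := relEnt_repr hρ' hσ' hs'
  have key := sum_mul_log_le (c := c') (t := t') (J := κ × (ι × ι))
    (c' := fun p => q p.1 * c p.1 p.2) (t' := fun p => t p.1 p.2) hct'
    (fun p hp => hct _ _ (right_ne_zero_of_mul hp)) ?_ ?_
  · rw [hrel']
    simp_rw [hrel]
    rw [Fintype.sum_prod_type] at key
    have : ∑ k, q k * (-(∑ p, c k p * Real.log (t k p)) / Real.log 2) =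
        -(∑ k, ∑ p, q k * c k p * Real.log (t k p)) / Real.log 2 := by
      rw [neg_div, Finset.sum_div, ← Finset.sum_neg_distrib]
      refine Finset.sum_congr rfl fun k _ => ?_
      simp_rw [mul_assoc, ← Finset.mul_sum]
      ring
    rw [this]
    exact div_le_div_of_nonneg_right (neg_le_neg key) (Real.log_pos one_lt_two).le
  · intro s h0
    obtain ⟨X', hX'⟩ := hex' s h0
    obtain ⟨X, hX⟩ := hres s h0 X'
    rw [← hX', Fintype.sum_prod_type]
    refine hX.trans (Finset.sum_le_sum fun k _ => ?_)
    simp_rw [mul_div_assoc, ← Finset.mul_sum]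
    exact mul_le_mul_of_nonneg_left (hle k s h0 (X k)) (hq k)
  · rw [hsum', ht, Fintype.sum_prod_type]
    simp_rw [← Finset.mul_sum, hsum]

end Monotonicity

section Channels

variable {α β γ : Type*} [Fintype α] [DecidableEq α] [Fintype β] [DecidableEq β]
  [Fintype γ] [DecidableEq γ]

theorem QChannel.cp_fintype (N : QChannel α β) (δ : Type*) [Fintype δ]
    {M : Matrix (δ × α) (δ × α) ℂ} (hM : M.PosSemidef) :
    ((lTensor δ N.map) M).PosSemidef := by
  have e := Fintype.equivFin δ
  have h := (N.cp _ _ (hM.submatrix (Prod.map e.symm id))).submatrix (Prod.map e id)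
  convert h using 1
  ext p q
  simp [lTensor]

/-- Composition of channels. -/
def QChannel.comp (N : QChannel β γ) (E : QChannel α β) : QChannel α γ where
  map := N.map ∘ₗ E.map
  cp n ρ hρ := N.cp n _ (E.cp n ρ hρ)
  tp ρ := by rw [LinearMap.comp_apply, N.tp, E.tp]

/-- Two-positivity of a linear map on matrices. -/
def TwoPos (L : Matrix α α ℂ →ₗ[ℂ] Matrix β β ℂ) : Prop :=
  ∀ M : Matrix (Fin 2 × α) (Fin 2 × α) ℂ, M.PosSemidef → ((lTensor (Fin 2) L) M).PosSemidef

theorem QChannel.twoPos_rTensor (N : QChannel α β) : TwoPos (rTensor γ N.map) := by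
  intro M hM
  have h := (N.cp_fintype (Fin 2 × γ) (hM.submatrix
    (fun p : (Fin 2 × γ) × α => (p.1.1, (p.2, p.1.2))))).submatrix
    (fun p : Fin 2 × (β × γ) => ((p.1, p.2.2), p.2.1))
  exact h

theorem trace_rTensor {L : Matrix α α ℂ →ₗ[ℂ] Matrix β β ℂ} (hL : ∀ ρ, (L ρ).trace = ρ.trace)
    (ρ : Matrix (α × γ) (α × γ) ℂ) : (rTensor γ L ρ).trace = ρ.trace := by
  have h : ∀ g, ∑ b, rTensor γ L ρ (b, g) (b, g) = ∑ a, ρ (a, g) (a, g) :=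
    fun g => hL (of fun a a' => ρ (a, g) (a', g))
  rw [trace, trace, Fintype.sum_prod_type_right, Fintype.sum_prod_type_right]
  exact Finset.sum_congr rfl fun g _ => h g

variable {L : Matrix α α ℂ →ₗ[ℂ] Matrix β β ℂ}

theorem TwoPos.block (hL : TwoPos L) {σ : Matrix α α ℂ} (hσ : σ.PosSemidef)
    (K : Fin 2 → Matrix α α ℂ) :
    (of fun p q : Fin 2 × β => L (K p.1 * σ * (K q.1)ᴴ) p.2 q.2).PosSemidef := by
  have h := hL _ (hσ.mul_mul_conjTranspose_same (of fun (p : Fin 2 × α) j => K p.1 p.2 j))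
  exact h

theorem TwoPos.sandwich (hL : TwoPos L) {σ : Matrix α α ℂ} (hσ : σ.PosSemidef)
    (K : Fin 2 → Matrix α α ℂ) (G : Fin 2 → Matrix β β ℂ) :
    (∑ a, ∑ b, G a * L (K a * σ * (K b)ᴴ) * (G b)ᴴ).PosSemidef := by
  have h := (hL.block hσ K).mul_mul_conjTranspose_same (of fun i (p : Fin 2 × β) => G p.1 i p.2)
  convert h using 1
  ext i j
  simp only [Matrix.sum_apply, mul_apply, Fintype.sum_prod_type, of_apply, conjTranspose_apply]
  rw [Finset.sum_comm]
  refine Finset.sum_congr rfl fun y _ => ?_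
  rw [Finset.sum_comm]
  simp_rw [Finset.sum_mul]

theorem TwoPos.posSemidef (hL : TwoPos L) {σ : Matrix α α ℂ} (hσ : σ.PosSemidef) :
    (L σ).PosSemidef := by
  have h := hL.sandwich hσ ![1, 0] ![1, 0]
  simpa [Fin.sum_univ_two] using h

theorem TwoPos.map_conjTranspose (hL : TwoPos L) (M : Matrix α α ℂ) : (L M)ᴴ = L Mᴴ := by
  have h := (hL.block PosSemidef.one ![M, 1]).isHermitian
  ext i j
  have := congrFun (congrFun h (1, i)) (0, j)
  simpa using this

/-- The adjoint of a linear map on matrices for the trace pairing. -/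
def traceAdjoint (L : Matrix α α ℂ →ₗ[ℂ] Matrix β β ℂ) (X : Matrix β β ℂ) : Matrix α α ℂ :=
  of fun j i => (X * L (single i j 1)).trace

theorem trace_mul_map (L : Matrix α α ℂ →ₗ[ℂ] Matrix β β ℂ) (X : Matrix β β ℂ)
    (ρ : Matrix α α ℂ) : (X * L ρ).trace = (traceAdjoint L X * ρ).trace := by
  have h : L ρ = ∑ i, ∑ j, ρ i j • L (single i j 1) := by
    conv_lhs => rw [matrix_eq_sum_single ρ]
    simp only [map_sum, ← map_smul, smul_single, smul_eq_mul, mul_one]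
  rw [h, trace_mul_comm (traceAdjoint L X)]
  simp only [Finset.mul_sum, trace_sum, Matrix.mul_smul, trace_smul, smul_eq_mul]
  simp only [trace, diag_apply, mul_apply, traceAdjoint, of_apply]

theorem TwoPos.trace_conjTranspose_mul_map (hL : TwoPos L) (X : Matrix β β ℂ)
    (ρ : Matrix α α ℂ) : (Xᴴ * L ρ).trace = ((traceAdjoint L X)ᴴ * ρ).trace := by
  have h := congrArg star (trace_mul_map L X ρᴴ)
  rw [← trace_conjTranspose, ← trace_conjTranspose, conjTranspose_mul, conjTranspose_mul,
    hL.map_conjTranspose, conjTranspose_conjTranspose] at h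
  rw [trace_mul_comm, h, trace_mul_comm]

/-- Kadison-Schwarz inequality for a map that is adjoint to a two-positive trace-preserving
map. -/
theorem TwoPos.schwarz (hL : TwoPos L) (htp : ∀ ρ, (L ρ).trace = ρ.trace)
    {X : Matrix β β ℂ} {Y : Matrix α α ℂ} (hXY : ∀ ρ, (X * L ρ).trace = (Y * ρ).trace)
    {σ : Matrix α α ℂ} (hσ : σ.PosSemidef) :
    (Y * σ * Yᴴ).trace.re ≤ (X * L σ * Xᴴ).trace.re := by
  have h := (Complex.nonneg_iff.1 (hL.sandwich hσ ![-Y, 1] ![1, X]).trace_nonneg).1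
  have h1 : (X * L (σ * Yᴴ)).trace = (Y * σ * Yᴴ).trace := by rw [hXY, Matrix.mul_assoc]
  have h2 : (L (Y * σ) * Xᴴ).trace.re = (Y * σ * Yᴴ).trace.re := by
    rw [← h1, ← Complex.conj_re, ← Complex.star_def, ← trace_conjTranspose, conjTranspose_mul,
      conjTranspose_conjTranspose, hL.map_conjTranspose, conjTranspose_mul, hσ.isHermitian.eq]
  simp only [Fin.sum_univ_two, cons_val_zero, cons_val_one, Matrix.one_mul, conjTranspose_one,
    Matrix.mul_one, conjTranspose_neg, Matrix.neg_mul, Matrix.mul_neg, neg_neg, map_neg,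
    trace_add, trace_neg, Complex.add_re, Complex.neg_re, h1, h2, htp] at h
  linarith

theorem TwoPos.exists_resForm_le (hL : TwoPos L) (htp : ∀ ρ, (L ρ).trace = ρ.trace)
    {ρ σ : Matrix α α ℂ} (hρ : ρ.PosSemidef) (hσ : σ.PosSemidef) {s : ℝ} (hs : 0 ≤ s)
    (X : Matrix β β ℂ) : ∃ Y, resForm s X (L ρ) (L σ) ≤ resForm s Y ρ σ := by
  refine ⟨traceAdjoint L X, ?_⟩
  have h1 := hL.schwarz htp (trace_mul_map L X) hσ
  have h2 := hL.schwarz htp (hL.trace_conjTranspose_mul_map X) hρ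
  rw [conjTranspose_conjTranspose, conjTranspose_conjTranspose] at h2
  rw [resForm, resForm, trace_mul_map]
  have := mul_le_mul_of_nonneg_left h2 hs
  linarith

/-- Data processing inequality for the relative entropy. -/
theorem TwoPos.relEnt_map_le (hL : TwoPos L) (htp : ∀ ρ, (L ρ).trace = ρ.trace)
    {ρ σ : Matrix α α ℂ} (hρ : ρ.PosSemidef) (hσ : σ.PosSemidef) (hs : SuppLE ρ σ)
    (hs' : SuppLE (L ρ) (L σ)) : relEnt (L ρ) (L σ) ≤ relEnt ρ σ := by
  have := relEnt_le_sum (κ := Unit) (q := fun _ => 1) (fun _ => zero_le_one) (fun _ => hρ)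
    (fun _ => hσ) (fun _ => hs) (hL.posSemidef hρ) (hL.posSemidef hσ) hs' (by simp [htp])
    (fun s h X' => by
      obtain ⟨Y, hY⟩ := hL.exists_resForm_le htp hρ hσ h.le X'
      exact ⟨fun _ => Y, by simpa using hY⟩)
  simpa using this

/-- Joint convexity of the relative entropy. -/
theorem relEnt_convex {κ : Type*} [Fintype κ] {q : κ → ℝ} (hq : ∀ k, 0 ≤ q k)
    {ρ σ : κ → Matrix α α ℂ}
    (hρ : ∀ k, (ρ k).PosSemidef) (hσ : ∀ k, (σ k).PosSemidef) (hs : ∀ k, SuppLE (ρ k) (σ k))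
    (hs' : SuppLE (∑ k, (q k : ℂ) • ρ k) (∑ k, (q k : ℂ) • σ k)) :
    relEnt (∑ k, (q k : ℂ) • ρ k) (∑ k, (q k : ℂ) • σ k) ≤ ∑ k, q k * relEnt (ρ k) (σ k) := by
  have hpos : ∀ τ : κ → Matrix α α ℂ, (∀ k, (τ k).PosSemidef) →
      (∑ k, (q k : ℂ) • τ k).PosSemidef := fun τ h =>
    posSemidef_sum _ fun k _ => (h k).smul (by exact_mod_cast hq k)
  refine relEnt_le_sum hq hρ hσ hs (hpos _ hρ) (hpos _ hσ) hs' ?_ fun s _ X => ⟨fun _ => X, ?_⟩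
  · simp [trace_sum, trace_smul]
  · refine le_of_eq ?_
    simp only [resForm, Finset.mul_sum, Finset.sum_mul, Matrix.mul_smul, Matrix.smul_mul,
      trace_sum, trace_smul, smul_eq_mul, Complex.re_sum, Complex.re_ofReal_mul,
      ← Finset.sum_sub_distrib]
    exact Finset.sum_congr rfl fun k _ => by ring

end Channels

section Bipartite

variable {α β : Type*} [Fintype α] [DecidableEq α] [Fintype β] [DecidableEq β]

theorem Diag.kronecker {A U : Matrix α α ℂ} {B V : Matrix β β ℂ} {a : α → ℝ} {b : β → ℝ}
    (hA : Diag A U a) (hB : Diag B V b) :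
    Diag (A ⊗ₖ B) (U ⊗ₖ V) (fun p => a p.1 * b p.2) := by
  refine .of_conj ?_ ?_
  · rw [conjTranspose_kronecker, ← mul_kronecker_mul, hA.unit, hB.unit, one_kronecker_one]
  · rw [conjTranspose_kronecker, ← mul_kronecker_mul, ← mul_kronecker_mul, hA.conj, hB.conj,
      diagonal_kronecker_diagonal]
    simp

theorem diag_one : Diag (1 : Matrix α α ℂ) 1 (fun _ => 1) := ⟨by simp, by simp⟩

theorem Diag.submatrix {σ U : Matrix α α ℂ} {d : α → ℝ} (h : Diag σ U d) (e : β ≃ α) :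
    Diag (σ.submatrix e e) (U.submatrix e e) (d ∘ e) := by
  refine ⟨?_, ?_⟩
  · rw [conjTranspose_submatrix, submatrix_mul_equiv, h.unit, submatrix_one_equiv]
  · have : diagonal (fun j => ((d ∘ e) j : ℂ)) =
        (diagonal (fun j => (d j : ℂ))).submatrix e e := by
      rw [submatrix_diagonal_equiv]; rfl
    rw [this, conjTranspose_submatrix, submatrix_mul_equiv, submatrix_mul_equiv, ← h.eq]

theorem entropy_submatrix {σ : Matrix α α ℂ} (h : σ.IsHermitian) (e : β ≃ α) :
    entropy (σ.submatrix e e) = entropy σ := by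
  obtain ⟨U, d, hU⟩ := exists_diag h
  rw [(hU.submatrix e).entropy_eq, hU.entropy_eq]
  exact e.sum_comp fun i => eta (d i)

theorem eta_mul (a b : ℝ) : eta (a * b) = a * eta b + eta a * b := by
  unfold eta
  rcases eq_or_ne a 0 with rfl | ha
  · simp
  rcases eq_or_ne b 0 with rfl | hb
  · simp
  rw [Real.logb_mul ha hb]; ring

theorem entropy_smul {σ : Matrix α α ℂ} (h : σ.IsHermitian) (c : ℝ) :
    entropy ((c : ℂ) • σ) = c * entropy σ + eta c * σ.trace.re := by
  obtain ⟨U, d, hU⟩ := exists_diag h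
  have hc : Diag ((c : ℂ) • σ) U (fun j => c * d j) := by
    refine .of_conj hU.unit ?_
    rw [Matrix.mul_smul, Matrix.smul_mul, hU.conj]
    ext i j
    by_cases hij : i = j <;> simp [hij]
  rw [hc.entropy_eq, hU.entropy_eq, hU.trace_re, Finset.mul_sum, Finset.mul_sum,
    ← Finset.sum_add_distrib]
  exact Finset.sum_congr rfl fun j _ => eta_mul _ _

theorem trace_mul_one_kronecker (ρ : Matrix (α × β) (α × β) ℂ) (Q : Matrix β β ℂ) :
    (ρ * ((1 : Matrix α α ℂ) ⊗ₖ Q)).trace = (ptrL ρ * Q).trace := by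
  simp only [trace, diag_apply, mul_apply, Fintype.sum_prod_type, kroneckerMap_apply, one_apply,
    ptrL, of_apply, Finset.sum_mul]
  rw [Finset.sum_comm]
  refine Finset.sum_congr rfl fun b _ => ?_
  rw [Finset.sum_comm (s := (Finset.univ : Finset β))]
  refine Finset.sum_congr rfl fun a _ => ?_
  rw [Finset.sum_comm]
  simp

theorem trace_mul_kronecker_one (ρ : Matrix (α × β) (α × β) ℂ) (Q : Matrix α α ℂ) :
    (ρ * (Q ⊗ₖ (1 : Matrix β β ℂ))).trace = (ptrR ρ * Q).trace := by
  simp only [trace, diag_apply, mul_apply, Fintype.sum_prod_type, kroneckerMap_apply, one_apply,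
    ptrR, of_apply, Finset.sum_mul]
  refine Finset.sum_congr rfl fun a _ => ?_
  rw [Finset.sum_comm]
  refine Finset.sum_congr rfl fun a' _ => ?_
  simp

theorem dg_eq_trace (ρ V : Matrix α α ℂ) (j : α) :
    dg ρ V j = (ρ * (V * single j j 1 * Vᴴ)).trace.re := by
  rw [← Matrix.mul_assoc, trace_mul_comm, ← Matrix.mul_assoc, ← Matrix.mul_assoc,
    trace_mul_single]
  simp [dg]

theorem sum_single_kronecker (j : β) :
    ∑ i : α, single (i, j) (i, j) (1 : ℂ) = (1 : Matrix α α ℂ) ⊗ₖ single j j (1 : ℂ) := by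
  ext ⟨a, b⟩ ⟨a', b'⟩
  simp [Matrix.sum_apply, single_apply, one_apply, ite_and]
  aesop

theorem sum_kronecker_single (i : α) :
    ∑ j : β, single (i, j) (i, j) (1 : ℂ) = single i i (1 : ℂ) ⊗ₖ (1 : Matrix β β ℂ) := by
  ext ⟨a, b⟩ ⟨a', b'⟩
  simp [Matrix.sum_apply, single_apply, one_apply, ite_and]
  aesop

theorem sum_dg_left (ρ : Matrix (α × β) (α × β) ℂ) {U : Matrix α α ℂ} (hU : Uᴴ * U = 1)
    (V : Matrix β β ℂ) (j : β) : ∑ i, dg ρ (U ⊗ₖ V) (i, j) = dg (ptrL ρ) V j := by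
  simp_rw [dg_eq_trace]
  rw [← Complex.re_sum, ← trace_sum, ← Finset.mul_sum, ← Finset.sum_mul, ← Finset.mul_sum,
    sum_single_kronecker, conjTranspose_kronecker, ← mul_kronecker_mul, ← mul_kronecker_mul,
    Matrix.mul_one, mul_eq_one_comm.1 hU, trace_mul_one_kronecker]

theorem sum_dg_right (ρ : Matrix (α × β) (α × β) ℂ) (U : Matrix α α ℂ)
    {V : Matrix β β ℂ} (hV : Vᴴ * V = 1) (i : α) :
    ∑ j, dg ρ (U ⊗ₖ V) (i, j) = dg (ptrR ρ) U i := by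
  simp_rw [dg_eq_trace]
  rw [← Complex.re_sum, ← trace_sum, ← Finset.mul_sum, ← Finset.sum_mul, ← Finset.mul_sum,
    sum_kronecker_single, conjTranspose_kronecker, ← mul_kronecker_mul, ← mul_kronecker_mul,
    Matrix.mul_one, mul_eq_one_comm.1 hV, trace_mul_kronecker_one]

theorem ptrL_posSemidef {ρ : Matrix (α × β) (α × β) ℂ} (h : ρ.PosSemidef) :
    (ptrL ρ).PosSemidef := by
  have : ptrL ρ = ∑ a, ρ.submatrix (fun b => (a, b)) (fun b => (a, b)) := by
    ext; simp [ptrL, Matrix.sum_apply]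
  rw [this]
  exact posSemidef_sum _ fun a _ => h.submatrix _

theorem ptrR_posSemidef {ρ : Matrix (α × β) (α × β) ℂ} (h : ρ.PosSemidef) :
    (ptrR ρ).PosSemidef := by
  have : ptrR ρ = ∑ b, ρ.submatrix (fun a => (a, b)) (fun a => (a, b)) := by
    ext; simp [ptrR, Matrix.sum_apply]
  rw [this]
  exact posSemidef_sum _ fun a _ => h.submatrix _

theorem trace_ptrL (ρ : Matrix (α × β) (α × β) ℂ) : (ptrL ρ).trace = ρ.trace := by
  simp [trace, ptrL, Fintype.sum_prod_type_right]

theorem trace_ptrR (ρ : Matrix (α × β) (α × β) ℂ) : (ptrR ρ).trace = ρ.trace := by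
  simp [trace, ptrR, Fintype.sum_prod_type]

theorem IsState.ptrL {ρ : Matrix (α × β) (α × β) ℂ} (h : IsState ρ) : IsState (ptrL ρ) :=
  ⟨ptrL_posSemidef h.1, by rw [trace_ptrL, h.2]⟩

theorem IsState.ptrR {ρ : Matrix (α × β) (α × β) ℂ} (h : IsState ρ) : IsState (ptrR ρ) :=
  ⟨ptrR_posSemidef h.1, by rw [trace_ptrR, h.2]⟩

theorem dg_eq_zero_of_left {ρ : Matrix (α × β) (α × β) ℂ} (h : ρ.PosSemidef) {U : Matrix α α ℂ}
    (hU : Uᴴ * U = 1) {V : Matrix β β ℂ} {j : β} (h0 : dg (ptrL ρ) V j = 0) (i : α) :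
    dg ρ (U ⊗ₖ V) (i, j) = 0 := by
  rw [← sum_dg_left ρ hU] at h0
  exact (Finset.sum_eq_zero_iff_of_nonneg fun i _ => dg_nonneg h _ _).1 h0 i (Finset.mem_univ _)

theorem dg_eq_zero_of_right {ρ : Matrix (α × β) (α × β) ℂ} (h : ρ.PosSemidef) {U : Matrix α α ℂ}
    {V : Matrix β β ℂ} (hV : Vᴴ * V = 1) {i : α} (h0 : dg (ptrR ρ) U i = 0) (j : β) :
    dg ρ (U ⊗ₖ V) (i, j) = 0 := by
  rw [← sum_dg_right ρ U hV] at h0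
  exact (Finset.sum_eq_zero_iff_of_nonneg fun j _ => dg_nonneg h _ _).1 h0 j (Finset.mem_univ _)

theorem suppLE_kronecker {ρ : Matrix (α × β) (α × β) ℂ} (h : ρ.PosSemidef) :
    SuppLE ρ (ptrR ρ ⊗ₖ ptrL ρ) := by
  obtain ⟨U, a, hU⟩ := exists_diag (ptrR_posSemidef h).isHermitian
  obtain ⟨V, b, hV⟩ := exists_diag (ptrL_posSemidef h).isHermitian
  refine ⟨_, _, hU.kronecker hV, fun ⟨i, j⟩ h0 => ?_⟩
  rcases mul_eq_zero.1 h0 with h0 | h0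
  · exact dg_eq_zero_of_right h hV.unit (by rw [hU.dg_self, h0]) _
  · exact dg_eq_zero_of_left h hU.unit (by rw [hV.dg_self, h0]) _

theorem mutualInfoD_eq {ρ : Matrix (α × β) (α × β) ℂ} (h : ρ.PosSemidef) :
    mutualInfoD ρ = entropy (ptrR ρ) + entropy (ptrL ρ) - entropy ρ := by
  obtain ⟨U, a, hU⟩ := exists_diag (ptrR_posSemidef h).isHermitian
  obtain ⟨V, b, hV⟩ := exists_diag (ptrL_posSemidef h).isHermitian
  rw [mutualInfoD, relEnt_eq_sub (hU.kronecker hV), hU.entropy_eq, hV.entropy_eq]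
  have key : ∑ p : α × β, dg ρ (U ⊗ₖ V) p * Real.logb 2 (a p.1 * b p.2) =
      ∑ p : α × β, dg ρ (U ⊗ₖ V) p * Real.logb 2 (a p.1) +
        ∑ p : α × β, dg ρ (U ⊗ₖ V) p * Real.logb 2 (b p.2) := by
    rw [← Finset.sum_add_distrib]
    refine Finset.sum_congr rfl fun ⟨i, j⟩ _ => ?_
    by_cases ha : a i = 0
    · rw [dg_eq_zero_of_right h hV.unit (by rw [hU.dg_self, ha])]; simp
    by_cases hb : b j = 0
    · rw [dg_eq_zero_of_left h hU.unit (by rw [hV.dg_self, hb])]; simp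
    rw [Real.logb_mul ha hb, mul_add]
  rw [key, Fintype.sum_prod_type, Fintype.sum_prod_type_right]
  simp_rw [← Finset.sum_mul, sum_dg_left ρ hU.unit, sum_dg_right ρ U hV.unit, hU.dg_self,
    hV.dg_self, eta, Finset.sum_neg_distrib]
  ring

theorem mutualInfoD_nonneg {ρ : Matrix (α × β) (α × β) ℂ} (h : IsState ρ) :
    0 ≤ mutualInfoD ρ := by
  refine relEnt_nonneg h.1 (h.ptrR.1.kronecker h.ptrL.1) (suppLE_kronecker h.1) ?_
  rw [trace_kronecker, h.ptrR.2, h.ptrL.2, h.2, one_mul]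

theorem suppLE_one_kronecker {ρ : Matrix (α × β) (α × β) ℂ} (h : ρ.PosSemidef) :
    SuppLE ρ ((1 : Matrix α α ℂ) ⊗ₖ ptrL ρ) := by
  obtain ⟨V, b, hV⟩ := exists_diag (ptrL_posSemidef h).isHermitian
  refine ⟨_, _, diag_one.kronecker hV, fun ⟨i, j⟩ h0 => ?_⟩
  rw [one_mul] at h0
  exact dg_eq_zero_of_left h (by simp) (by rw [hV.dg_self, h0]) _

theorem relEnt_one_kronecker {ρ : Matrix (α × β) (α × β) ℂ} (h : ρ.PosSemidef) :
    relEnt ρ ((1 : Matrix α α ℂ) ⊗ₖ ptrL ρ) = entropy (ptrL ρ) - entropy ρ := by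
  obtain ⟨V, b, hV⟩ := exists_diag (ptrL_posSemidef h).isHermitian
  rw [relEnt_eq_sub (diag_one.kronecker hV), hV.entropy_eq, Fintype.sum_prod_type_right]
  simp_rw [one_mul, ← Finset.sum_mul, sum_dg_left ρ (show (1 : Matrix α α ℂ)ᴴ * 1 = 1 by simp),
    hV.dg_self, eta, Finset.sum_neg_distrib]
  ring

/-- Concavity of the conditional entropy. -/
theorem condEntropy_concave {κ : Type*} [Fintype κ] {q : κ → ℝ} (hq : ∀ k, 0 ≤ q k)
    {ρ : κ → Matrix (α × β) (α × β) ℂ} (hρ : ∀ k, (ρ k).PosSemidef) :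
    entropy (ptrL (∑ k, (q k : ℂ) • ρ k)) - entropy (∑ k, (q k : ℂ) • ρ k) ≤
      ∑ k, q k * (entropy (ptrL (ρ k)) - entropy (ρ k)) := by
  have hsum : (∑ k, (q k : ℂ) • ρ k).PosSemidef :=
    posSemidef_sum _ fun k _ => (hρ k).smul (by exact_mod_cast hq k)
  have hlin : ∑ k, (q k : ℂ) • ((1 : Matrix α α ℂ) ⊗ₖ ptrL (ρ k)) =
      (1 : Matrix α α ℂ) ⊗ₖ ptrL (∑ k, (q k : ℂ) • ρ k) := by
    ext ⟨a, b⟩ ⟨a', b'⟩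
    simp only [Matrix.sum_apply, Matrix.smul_apply, kroneckerMap_apply, ptrL, of_apply,
      smul_eq_mul]
    rw [Finset.sum_comm]
    simp_rw [← Finset.mul_sum]
    rw [Finset.mul_sum]
    exact Finset.sum_congr rfl fun k _ => by ring
  have h := relEnt_convex hq hρ (fun k => PosSemidef.one.kronecker (ptrL_posSemidef (hρ k)))
    (fun k => suppLE_one_kronecker (hρ k)) (by rw [hlin]; exact suppLE_one_kronecker hsum)
  rw [hlin, relEnt_one_kronecker hsum] at h
  simpa only [relEnt_one_kronecker (hρ _)] using h

theorem entropy_le_sum_eta_dg {σ V : Matrix α α ℂ} (hσ : σ.PosSemidef) (hV : Vᴴ * V = 1) :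
    entropy σ ≤ ∑ y, eta (dg σ V y) := by
  have hD : Diag (V * diagonal (fun j => (dg σ V j : ℂ)) * Vᴴ) V (dg σ V) := ⟨hV, rfl⟩
  have hp : (V * diagonal (fun j => (dg σ V j : ℂ)) * Vᴴ).PosSemidef := by
    refine PosSemidef.mul_mul_conjTranspose_same (.diagonal fun j => ?_) _
    exact Complex.zero_le_real.2 (dg_nonneg hσ V j)
  have h := relEnt_nonneg hσ hp ⟨_, _, hD, fun j h => h⟩ (by rw [hD.trace_re, sum_dg σ hV])
  rw [relEnt_eq_sub hD] at h
  simp only [eta, Finset.sum_neg_distrib]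
  linarith

theorem eta_le {x : ℝ} (hx : 0 ≤ x) : eta x ≤ 1 / Real.log 2 := by
  have hl : 0 < Real.log 2 := Real.log_pos one_lt_two
  rw [eta, Real.logb, le_div_iff₀ hl]
  have : -(x * (Real.log x / Real.log 2)) * Real.log 2 = -(x * Real.log x) := by field_simp
  rw [this]
  rcases hx.eq_or_lt with rfl | hx
  · simp
  have h1 := Real.one_sub_inv_le_log_of_pos hx
  have h2 := mul_le_mul_of_nonneg_left h1 hx.le
  rw [mul_sub, mul_inv_cancel₀ hx.ne'] at h2
  linarith

theorem eta_nonneg {x : ℝ} (hx : 0 ≤ x) (h1 : x ≤ 1) : 0 ≤ eta x :=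
  neg_nonneg.2 (mul_nonpos_of_nonneg_of_nonpos hx (Real.logb_nonpos one_lt_two hx h1))

theorem entropy_le {σ : Matrix α α ℂ} (hσ : σ.PosSemidef) :
    entropy σ ≤ Fintype.card α * (1 / Real.log 2) := by
  obtain ⟨U, d, hU⟩ := exists_diag hσ.isHermitian
  rw [hU.entropy_eq]
  refine (Finset.sum_le_sum fun j _ => eta_le (hU.nonneg hσ j)).trans ?_
  simp

theorem entropy_nonneg {σ : Matrix α α ℂ} (hσ : IsState σ) : 0 ≤ entropy σ := by
  obtain ⟨U, d, hU⟩ := exists_diag hσ.1.isHermitian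
  rw [hU.entropy_eq]
  have ht := hU.trace_re
  rw [hσ.2, Complex.one_re] at ht
  refine Finset.sum_nonneg fun j _ => eta_nonneg (hU.nonneg hσ.1 j) ?_
  rw [ht]
  exact Finset.single_le_sum (fun i _ => hU.nonneg hσ.1 i) (Finset.mem_univ j)

end Bipartite

section Pinching

variable {α β : Type*} [Fintype α] [DecidableEq α] [Fintype β] [DecidableEq β]

/-- The operator `Σ_y M_y ⊗ |φ_y⟩⟨φ_y|`, where `φ_y` are the columns of `V`. -/
def blockOp (M : β → Matrix α α ℂ) (V : Matrix β β ℂ) : Matrix (α × β) (α × β) ℂ :=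
  ∑ y : β, M y ⊗ₖ vecMulVec (fun b => V b y) (star fun b => V b y)

theorem blockOp_posSemidef {M : β → Matrix α α ℂ} (hM : ∀ y, (M y).PosSemidef)
    (V : Matrix β β ℂ) : (blockOp M V).PosSemidef :=
  posSemidef_sum _ fun y _ => (hM y).kronecker (posSemidef_vecMulVec_self_star _)

/-- The eigenbasis of a block operator assembled from eigenbases of the blocks. -/
def blockBasis (U : β → Matrix α α ℂ) (V : Matrix β β ℂ) : Matrix (α × β) (α × β) ℂ :=
  of fun p q => U q.2 p.1 q.1 * V p.2 q.2

theorem unitary_apply {V : Matrix β β ℂ} (hV : Vᴴ * V = 1) (y z : β) :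
    ∑ b, star (V b y) * V b z = if y = z then 1 else 0 := by
  have := congrFun (congrFun hV y) z
  rwa [mul_apply, one_apply] at this

theorem blockBasis_unitary {U : β → Matrix α α ℂ} {V : Matrix β β ℂ} (hU : ∀ y, (U y)ᴴ * U y = 1)
    (hV : Vᴴ * V = 1) : (blockBasis U V)ᴴ * blockBasis U V = 1 := by
  ext ⟨i, y⟩ ⟨j, z⟩
  have h : ((blockBasis U V)ᴴ * blockBasis U V) (i, y) (j, z) =
      (∑ a, star (U y a i) * U z a j) * ∑ b, star (V b y) * V b z := by
    simp only [mul_apply, conjTranspose_apply, blockBasis, of_apply, Fintype.sum_prod_type,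
      Finset.sum_mul_sum, star_mul']
    exact Finset.sum_congr rfl fun a _ => Finset.sum_congr rfl fun b _ => by ring
  rw [h, unitary_apply hV]
  by_cases hyz : y = z
  · subst hyz
    rw [unitary_apply (hU y)]
    simp [one_apply]
  · simp [hyz]

theorem blockOp_diag {M U : β → Matrix α α ℂ} {d : β → α → ℝ} {V : Matrix β β ℂ}
    (hM : ∀ y, Diag (M y) (U y) (d y)) (hV : Vᴴ * V = 1) :
    Diag (blockOp M V) (blockBasis U V) (fun p => d p.2 p.1) := by
  refine .of_mul (blockBasis_unitary (fun y => (hM y).unit) hV) ?_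
  ext ⟨a, b⟩ ⟨i, y⟩
  rw [mul_diagonal]
  have h : (blockOp M V * blockBasis U V) (a, b) (i, y) =
      ∑ z, (∑ a', M z a a' * U y a' i) * V b z * ∑ b', star (V b' z) * V b' y := by
    simp only [mul_apply, blockOp, blockBasis, of_apply, Fintype.sum_prod_type, Matrix.sum_apply,
      kroneckerMap_apply, vecMulVec_apply, Pi.star_apply, Finset.sum_mul (s := (Finset.univ : Finset β))]
    refine (Finset.sum_congr rfl fun a' _ => Finset.sum_comm).trans
      (Finset.sum_comm.trans (Finset.sum_congr rfl fun z _ => ?_))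
    rw [Finset.sum_mul, Finset.sum_mul_sum]
    exact Finset.sum_congr rfl fun a' _ => Finset.sum_congr rfl fun b' _ => by ring
  rw [h]
  simp_rw [unitary_apply hV]
  have hMU : M y * U y = U y * diagonal (fun j => (d y j : ℂ)) := by
    rw [← (hM y).conj, ← Matrix.mul_assoc, ← Matrix.mul_assoc, (hM y).unit', Matrix.one_mul]
  have h2 := congrFun (congrFun hMU a) i
  rw [mul_apply, mul_diagonal] at h2
  simp [h2, blockBasis]
  ring

theorem entropy_blockOp {M : β → Matrix α α ℂ} (hM : ∀ y, (M y).IsHermitian) {V : Matrix β β ℂ}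
    (hV : Vᴴ * V = 1) : entropy (blockOp M V) = ∑ y, entropy (M y) := by
  choose U d hU using fun y => exists_diag (hM y)
  rw [(blockOp_diag hU hV).entropy_eq, Fintype.sum_prod_type_right]
  exact Finset.sum_congr rfl fun y _ => (hU y).entropy_eq.symm

theorem exists_isometry_sandwichR (v : β → ℂ) : ∃ J : Matrix (α × β) α ℂ,
    (∀ ρ : Matrix (α × β) (α × β) ℂ, sandwichR ρ v = Jᴴ * ρ * J) ∧
      ∀ (U : Matrix α α ℂ) a b i, (J * U) (a, b) i = U a i * v b := by
  refine ⟨of fun p a' => if p.1 = a' then v p.2 else 0, fun ρ => ?_, fun U a b i => ?_⟩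
  · ext a a'
    simp [sandwichR, mul_apply, Fintype.sum_prod_type, Finset.sum_mul, apply_ite star]
    rw [Finset.sum_comm]
  · simp [mul_apply, mul_comm]

theorem sandwichR_posSemidef {ρ : Matrix (α × β) (α × β) ℂ} (h : ρ.PosSemidef) (v : β → ℂ) :
    (sandwichR ρ v).PosSemidef := by
  obtain ⟨J, hJ, -⟩ := exists_isometry_sandwichR (α := α) v
  rw [hJ]
  exact h.conjTranspose_mul_mul_same J

theorem dg_blockBasis (ρ : Matrix (α × β) (α × β) ℂ) (U : β → Matrix α α ℂ) (V : Matrix β β ℂ)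
    (i : α) (y : β) :
    dg ρ (blockBasis U V) (i, y) = dg (sandwichR ρ fun b => V b y) (U y) i := by
  obtain ⟨J, hJ, hJU⟩ := exists_isometry_sandwichR (α := α) (fun b => V b y)
  rw [dg, dg, hJ]
  have h : (U y)ᴴ * (Jᴴ * ρ * J) * U y = (J * U y)ᴴ * ρ * (J * U y) := by
    simp only [conjTranspose_mul, Matrix.mul_assoc]
  rw [h]
  have hcol : ∀ p, blockBasis U V p (i, y) = (J * U y) p i := fun p => (hJU (U y) p.1 p.2 i).symm
  congr 1
  rw [mul_apply (M := (blockBasis U V)ᴴ * ρ), mul_apply (M := (J * U y)ᴴ * ρ)]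
  refine Finset.sum_congr rfl fun q _ => ?_
  rw [mul_apply (N := ρ), mul_apply (N := ρ), hcol]
  simp only [conjTranspose_apply, hcol]

/-- The state after a projective measurement of the second factor in the basis of columns
of `V`. -/
def pinch (ρ : Matrix (α × β) (α × β) ℂ) (V : Matrix β β ℂ) : Matrix (α × β) (α × β) ℂ :=
  blockOp (fun y => sandwichR ρ fun b => V b y) V

theorem pinch_posSemidef {ρ : Matrix (α × β) (α × β) ℂ} (h : ρ.PosSemidef) (V : Matrix β β ℂ) :
    (pinch ρ V).PosSemidef :=
  blockOp_posSemidef (fun _ => sandwichR_posSemidef h _) V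

theorem exists_diag_pinch {ρ : Matrix (α × β) (α × β) ℂ} (h : ρ.PosSemidef) {V : Matrix β β ℂ}
    (hV : Vᴴ * V = 1) : ∃ W, Diag (pinch ρ V) W (dg ρ W) := by
  choose U d hU using fun y => exists_diag
    (sandwichR_posSemidef h fun b => V b y).isHermitian
  refine ⟨blockBasis U V, ?_⟩
  have := blockOp_diag hU hV
  have hd : dg ρ (blockBasis U V) = fun p => d p.2 p.1 := by
    funext ⟨i, y⟩
    rw [dg_blockBasis, (hU y).dg_self]
  rwa [hd]

theorem suppLE_pinch {ρ : Matrix (α × β) (α × β) ℂ} (h : ρ.PosSemidef) {V : Matrix β β ℂ}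
    (hV : Vᴴ * V = 1) : SuppLE ρ (pinch ρ V) := by
  obtain ⟨W, hW⟩ := exists_diag_pinch h hV
  exact ⟨W, _, hW, fun j h => h⟩

theorem relEnt_pinch {ρ : Matrix (α × β) (α × β) ℂ} (h : ρ.PosSemidef) {V : Matrix β β ℂ}
    (hV : Vᴴ * V = 1) : relEnt ρ (pinch ρ V) = entropy (pinch ρ V) - entropy ρ := by
  obtain ⟨W, hW⟩ := exists_diag_pinch h hV
  rw [relEnt_eq_sub hW, hW.entropy_eq]
  simp only [eta, Finset.sum_neg_distrib]
  ring

theorem relEnt_pinch_nonneg {ρ : Matrix (α × β) (α × β) ℂ} (h : ρ.PosSemidef) {V : Matrix β β ℂ}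
    (hV : Vᴴ * V = 1) : 0 ≤ relEnt ρ (pinch ρ V) := by
  obtain ⟨W, hW⟩ := exists_diag_pinch h hV
  refine relEnt_nonneg h (pinch_posSemidef h V) (suppLE_pinch h hV) ?_
  rw [hW.trace_re, sum_dg ρ hW.unit]

theorem trace_sandwichR (ρ : Matrix (α × β) (α × β) ℂ) (V : Matrix β β ℂ) (y : β) :
    (sandwichR ρ fun b => V b y).trace.re = dg (ptrL ρ) V y := by
  rw [dg]
  congr 1
  simp only [trace, diag_apply, sandwichR, of_apply, mul_apply, conjTranspose_apply, ptrL,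
    Finset.mul_sum, Finset.sum_mul]
  rw [Finset.sum_comm]
  simp_rw [Finset.sum_comm (s := (Finset.univ : Finset α))]
  rw [Finset.sum_comm]

theorem sum_sandwichR (ρ : Matrix (α × β) (α × β) ℂ) {V : Matrix β β ℂ} (hV : Vᴴ * V = 1) :
    ∑ y, sandwichR ρ (fun b => V b y) = ptrR ρ := by
  ext a a'
  have hV' : ∀ b b', ∑ y, star (V b y) * V b' y = if b = b' then 1 else 0 := by
    intro b b'
    have hVV : V * Vᴴ = 1 := mul_eq_one_comm.1 hV
    have := congrFun (congrFun hVV b') b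
    rw [mul_apply, one_apply] at this
    simp_rw [conjTranspose_apply] at this
    simp_rw [mul_comm (star _), this, eq_comm]
  simp only [Matrix.sum_apply, sandwichR, of_apply, ptrR]
  rw [Finset.sum_comm]
  refine Finset.sum_congr rfl fun b _ => ?_
  rw [Finset.sum_comm]
  have : ∀ b', ∑ y, star (V b y) * ρ (a, b) (a', b') * V b' y =
      ρ (a, b) (a', b') * if b = b' then 1 else 0 := by
    intro b'
    rw [← hV', Finset.mul_sum]
    exact Finset.sum_congr rfl fun y _ => by ring
  simp_rw [this]
  simp

theorem cqState_eq (p : β → ℝ) (σ : β → Matrix α α ℂ) :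
    cqState p σ = (blockOp (fun x => (p x : ℂ) • σ x) 1).submatrix
      (Equiv.prodComm β α) (Equiv.prodComm β α) := by
  ext ⟨x, a⟩ ⟨x', a'⟩
  by_cases h : x = x'
  · subst h
    simp [cqState, blockOp, Matrix.sum_apply, vecMulVec_apply, one_apply, apply_ite star]
  · simp [cqState, blockOp, Matrix.sum_apply, vecMulVec_apply, one_apply, apply_ite star, h]

variable {p : β → ℝ} {σ : β → Matrix α α ℂ}

theorem cqState_posSemidef (hp : ∀ x, 0 ≤ p x) (hσ : ∀ x, (σ x).PosSemidef) :
    (cqState p σ).PosSemidef := by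
  rw [cqState_eq]
  exact (blockOp_posSemidef (fun x => (hσ x).smul (Complex.zero_le_real.2 (hp x))) 1).submatrix _

theorem entropy_cqState (hp : ∀ x, 0 ≤ p x) (hσ : ∀ x, IsState (σ x)) :
    entropy (cqState p σ) = ∑ x, eta (p x) + ∑ x, p x * entropy (σ x) := by
  have h : ∀ x, ((p x : ℂ) • σ x).PosSemidef :=
    fun x => (hσ x).1.smul (Complex.zero_le_real.2 (hp x))
  rw [cqState_eq, entropy_submatrix (blockOp_posSemidef h 1).isHermitian,
    entropy_blockOp (fun x => (h x).isHermitian) (by simp), ← Finset.sum_add_distrib]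
  refine Finset.sum_congr rfl fun x _ => ?_
  rw [entropy_smul (hσ x).1.isHermitian, (hσ x).2, Complex.one_re]
  ring

theorem ptrL_cqState : ptrL (cqState p σ) = ∑ x, (p x : ℂ) • σ x := by
  ext a a'
  simp [ptrL, cqState, Matrix.sum_apply]

theorem entropy_ptrR_cqState (hσ : ∀ x, IsState (σ x)) :
    entropy (ptrR (cqState p σ)) = ∑ x, eta (p x) := by
  refine Diag.entropy_eq (U := 1) ⟨by simp, ?_⟩
  ext x x'
  by_cases h : x = x'
  · subst h
    have := (hσ x).2
    simp only [trace, diag_apply] at this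
    simp [ptrR, cqState, ← Finset.mul_sum, this]
  · simp [ptrR, cqState, h]

theorem isState_sum {κ : Type*} [Fintype κ] {q : κ → ℝ} {τ : κ → Matrix α α ℂ}
    (hq : IsProbDist q) (hτ : ∀ x, IsState (τ x)) : IsState (∑ x, (q x : ℂ) • τ x) := by
  refine ⟨posSemidef_sum _ fun x _ => (hτ x).1.smul (Complex.zero_le_real.2 (hq.1 x)), ?_⟩
  rw [trace_sum]
  simp_rw [trace_smul, (hτ _).2, smul_eq_mul, mul_one]
  exact_mod_cast hq.2

theorem mutualInfoD_cqState (hp : IsProbDist p) (hσ : ∀ x, IsState (σ x)) :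
    mutualInfoD (cqState p σ) =
      entropy (∑ x, (p x : ℂ) • σ x) - ∑ x, p x * entropy (σ x) := by
  rw [mutualInfoD_eq (cqState_posSemidef hp.1 fun x => (hσ x).1), entropy_ptrR_cqState hσ,
    entropy_cqState hp.1 hσ, ptrL_cqState]
  ring

theorem isState_cqState (hp : IsProbDist p) (hσ : ∀ x, IsState (σ x)) :
    IsState (cqState p σ) := by
  refine ⟨cqState_posSemidef hp.1 fun x => (hσ x).1, ?_⟩
  rw [← trace_ptrL, ptrL_cqState, (isState_sum hp hσ).2]

end Pinching

section Assistance

variable {α α' β γ : Type*} [Fintype α] [DecidableEq α] [Fintype α'] [DecidableEq α']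
  [Fintype β] [DecidableEq β] [Fintype γ] [DecidableEq γ]

section Tensor

variable (L : Matrix α α ℂ →ₗ[ℂ] Matrix α' α' ℂ)

theorem rTensor_kronecker (T : Matrix α α ℂ) (Q : Matrix β β ℂ) :
    rTensor β L (T ⊗ₖ Q) = L T ⊗ₖ Q := by
  ext ⟨a, b⟩ ⟨a', b'⟩
  have h : (of fun i j => (T ⊗ₖ Q) (i, b) (j, b')) = Q b b' • T := by
    ext i j
    simp [mul_comm]
  change L (of fun i j => (T ⊗ₖ Q) (i, b) (j, b')) a a' = _
  rw [h, map_smul]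
  simp [mul_comm]

theorem sandwichR_eq_sum (τ : Matrix (α × β) (α × β) ℂ) (v : β → ℂ) :
    sandwichR τ v = ∑ b, ∑ b', (star (v b) * v b') • of fun a a' => τ (a, b) (a', b') := by
  ext a a'
  simp only [sandwichR, of_apply, Matrix.sum_apply, Matrix.smul_apply, smul_eq_mul]
  exact Finset.sum_congr rfl fun b _ => Finset.sum_congr rfl fun b' _ => by ring

theorem sandwichR_rTensor (τ : Matrix (α × β) (α × β) ℂ) (v : β → ℂ) :
    sandwichR (rTensor β L τ) v = L (sandwichR τ v) := by
  rw [sandwichR_eq_sum, sandwichR_eq_sum]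
  simp only [map_sum, map_smul]
  rfl

theorem ptrR_rTensor (τ : Matrix (α × β) (α × β) ℂ) :
    ptrR (rTensor β L τ) = L (ptrR τ) := by
  have h : ptrR τ = ∑ b, of fun a a' => τ (a, b) (a', b) := by
    ext a a'
    simp [ptrR, Matrix.sum_apply]
  rw [h, map_sum]
  ext a a'
  simp [ptrR, Matrix.sum_apply, rTensor]

theorem rTensor_blockOp (M : β → Matrix α α ℂ) (V : Matrix β β ℂ) :
    rTensor β L (blockOp M V) = blockOp (fun y => L (M y)) V := by
  simp only [blockOp, map_sum, rTensor_kronecker]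

theorem rTensor_pinch (τ : Matrix (α × β) (α × β) ℂ) (V : Matrix β β ℂ) :
    rTensor β L (pinch τ V) = pinch (rTensor β L τ) V := by
  simp only [pinch, rTensor_blockOp, sandwichR_rTensor]

variable {L}

theorem ptrL_rTensor (hL : ∀ ρ, (L ρ).trace = ρ.trace) (τ : Matrix (α × β) (α × β) ℂ) :
    ptrL (rTensor β L τ) = ptrL τ := by
  ext b b'
  exact hL (of fun a a' => τ (a, b) (a', b'))

end Tensor

theorem QChannel.isState_map (N : QChannel α α') {σ : Matrix α α ℂ} (h : IsState σ) :
    IsState (N.map σ) := by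
  refine ⟨?_, by rw [N.tp, h.2]⟩
  have := ((N.cp_fintype Unit (h.1.submatrix Prod.snd)).submatrix fun a => ((), a))
  exact this

theorem QChannel.isState_rTensor (N : QChannel α α') {τ : Matrix (α × β) (α × β) ℂ}
    (h : IsState τ) : IsState (rTensor β N.map τ) :=
  ⟨(N.twoPos_rTensor).posSemidef h.1, by rw [trace_rTensor N.tp, h.2]⟩

/-- Data processing under pinching: discord controls the entropy gain of a local channel. -/
theorem entropy_sub_le_relEnt_pinch (N : QChannel α α') {τ : Matrix (α × β) (α × β) ℂ}
    (h : IsState τ) {V : Matrix β β ℂ} (hV : Vᴴ * V = 1) :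
    entropy (ptrL τ) - entropy (rTensor β N.map τ) ≤ relEnt τ (pinch τ V) +
      ∑ y, (eta (dg (ptrL τ) V y) - entropy (N.map (sandwichR τ fun b => V b y))) := by
  have hΦ := N.isState_rTensor h
  have h1 := (N.twoPos_rTensor (γ := β)).relEnt_map_le (trace_rTensor N.tp) h.1
    (pinch_posSemidef h.1 V) (suppLE_pinch h.1 hV)
    (by rw [rTensor_pinch]; exact suppLE_pinch hΦ.1 hV)
  rw [rTensor_pinch, relEnt_pinch hΦ.1 hV] at h1
  have h2 : entropy (pinch (rTensor β N.map τ) V) =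
      ∑ y, entropy (N.map (sandwichR τ fun b => V b y)) := by
    rw [pinch, entropy_blockOp (fun y => (sandwichR_posSemidef hΦ.1 _).isHermitian) hV]
    simp only [sandwichR_rTensor]
  have h3 := entropy_le_sum_eta_dg (ptrL_posSemidef h.1) hV
  rw [Finset.sum_sub_distrib]
  linarith

/-- Post-measurement ensemble of a state. -/
theorem exists_ensemble {τ : Matrix (α × β) (α × β) ℂ} (h : IsState τ) {V : Matrix β β ℂ}
    (hV : Vᴴ * V = 1) : ∃ (r : β → ℝ) (σ : β → Matrix α α ℂ), IsProbDist r ∧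
      (∀ y, IsState (σ y)) ∧ (∑ y, (r y : ℂ) • σ y = ptrR τ) ∧
      ∀ {δ : Type _} [Fintype δ] [DecidableEq δ] (N : QChannel α δ),
        entropy (ptrL τ) - entropy (rTensor β N.map τ) ≤
          relEnt τ (pinch τ V) - ∑ y, r y * entropy (N.map (σ y)) := by
  have hs := fun y => sandwichR_posSemidef h.1 fun b => V b y
  have hr : ∀ y, (sandwichR τ fun b => V b y).trace = (dg (ptrL τ) V y : ℂ) := by
    intro y
    rw [← trace_sandwichR]
    exact (Complex.ext rfl (hs y).trace_nonneg.2.symm)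
  have key : ∀ y, ∃ σ, IsState σ ∧
      (sandwichR τ fun b => V b y) = (dg (ptrL τ) V y : ℂ) • σ := by
    intro y
    by_cases h0 : dg (ptrL τ) V y = 0
    · refine ⟨ptrR τ, h.ptrR, ?_⟩
      have := hr y
      rw [h0, Complex.ofReal_zero, (hs y).trace_eq_zero_iff] at this
      rw [this, h0]
      simp
    · refine ⟨((dg (ptrL τ) V y)⁻¹ : ℝ) • sandwichR τ fun b => V b y, ⟨?_, ?_⟩, ?_⟩
      · exact (hs y).smul (inv_nonneg.2 (dg_nonneg h.ptrL.1 V y))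
      · rw [trace_smul, hr, Complex.real_smul, ← Complex.ofReal_mul, inv_mul_cancel₀ h0]
        simp
      · ext a a'
        simp [h0]
  choose σ hσ hσ' using key
  refine ⟨fun y => dg (ptrL τ) V y, σ, ⟨fun y => dg_nonneg h.ptrL.1 V y, ?_⟩, hσ, ?_, ?_⟩
  · rw [sum_dg _ hV, h.ptrL.2, Complex.one_re]
  · simp_rw [← hσ', sum_sandwichR τ hV]
  · intro δ _ _ N
    refine (entropy_sub_le_relEnt_pinch N h hV).trans (le_of_eq ?_)
    rw [sub_eq_add_neg, ← Finset.sum_neg_distrib]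
    congr 1
    refine Finset.sum_congr rfl fun y _ => ?_
    have := N.isState_map (hσ y)
    rw [hσ', map_smul, entropy_smul this.1.isHermitian, this.2, Complex.one_re]
    ring

end Assistance

section Enhancement

variable {EA EB A B : Type*} [Fintype EA] [DecidableEq EA] [Fintype EB] [DecidableEq EB]
  [Fintype A] [DecidableEq A] [Fintype B] [DecidableEq B]

theorem bddAbove_holevoD (N : QChannel A B) :
    BddAbove { r | ∃ (n : ℕ) (p : Fin n → ℝ) (σ : Fin n → Matrix A A ℂ),
      IsProbDist p ∧ (∀ x, IsState (σ x)) ∧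
      r = mutualInfoD (cqState p fun x => N.map (σ x)) } := by
  refine ⟨Fintype.card B * (1 / Real.log 2), ?_⟩
  rintro _ ⟨n, p, σ, hp, hσ, rfl⟩
  have hN := fun x => N.isState_map (hσ x)
  rw [mutualInfoD_cqState hp hN]
  have h1 := entropy_le (isState_sum hp hN).1
  have h2 := Finset.sum_nonneg fun x (_ : x ∈ Finset.univ) =>
    mul_nonneg (hp.1 x) (entropy_nonneg (hN x))
  linarith

theorem holevoD_nonneg (N : QChannel A B) : 0 ≤ holevoD N := by
  refine Real.sSup_nonneg ?_
  rintro _ ⟨n, p, σ, hp, hσ, rfl⟩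
  exact mutualInfoD_nonneg (isState_cqState hp fun x => N.isState_map (hσ x))

/-- The Holevo quantity of any finite ensemble is bounded by the Holevo information. -/
theorem entropy_sub_le_holevoD {κ : Type*} [Fintype κ] (N : QChannel A B) {q : κ → ℝ}
    {σ : κ → Matrix A A ℂ} (hq : IsProbDist q) (hσ : ∀ k, IsState (σ k)) :
    entropy (∑ k, (q k : ℂ) • N.map (σ k)) - ∑ k, q k * entropy (N.map (σ k)) ≤ holevoD N := by
  let e := (Fintype.equivFin κ).symm
  have hq' : IsProbDist fun x => q (e x) := ⟨fun x => hq.1 _, by rw [e.sum_comp q, hq.2]⟩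
  refine le_csSup (bddAbove_holevoD N) ⟨_, fun x => q (e x), fun x => σ (e x), hq',
    fun x => hσ _, ?_⟩
  rw [mutualInfoD_cqState hq' fun x => N.isState_map (hσ (e x)),
    e.sum_comp fun k => (q k : ℂ) • N.map (σ k), e.sum_comp fun k => q k * entropy (N.map (σ k))]

variable {N : QChannel A B} {ρ : Matrix (EA × EB) (EA × EB) ℂ}

theorem isState_assistedOut (hρ : IsState ρ) (E : QChannel EA A) :
    IsState (assistedOut N E ρ) :=
  (N.comp E).isState_rTensor hρ

theorem ptrL_assistedOut (E : QChannel EA A) : ptrL (assistedOut N E ρ) = ptrL ρ :=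
  ptrL_rTensor (N.comp E).tp ρ

theorem ptrR_assistedOut (E : QChannel EA A) :
    ptrR (assistedOut N E ρ) = N.map (E.map (ptrR ρ)) :=
  ptrR_rTensor _ ρ

theorem ptrR_sum_smul {κ α β : Type*} [Fintype κ] [Fintype β] (q : κ → ℝ)
    (τ : κ → Matrix (α × β) (α × β) ℂ) :
    ptrR (∑ k, (q k : ℂ) • τ k) = ∑ k, (q k : ℂ) • ptrR (τ k) := by
  ext a a'
  simp only [ptrR, of_apply, Matrix.sum_apply, Matrix.smul_apply, smul_eq_mul, Finset.mul_sum]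
  exact Finset.sum_comm

theorem ptrL_sum_smul {κ α β : Type*} [Fintype κ] [Fintype α] (q : κ → ℝ)
    (τ : κ → Matrix (α × β) (α × β) ℂ) :
    ptrL (∑ k, (q k : ℂ) • τ k) = ∑ k, (q k : ℂ) • ptrL (τ k) := by
  ext a a'
  simp only [ptrL, of_apply, Matrix.sum_apply, Matrix.smul_apply, smul_eq_mul, Finset.mul_sum]
  exact Finset.sum_comm

variable {n : ℕ} {p : Fin n → ℝ} {E : Fin n → QChannel EA A}

theorem infoXE_B_D_assistedCQ (hρ : IsState ρ) (hp : IsProbDist p) :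
    infoXE_B_D (assistedCQ N ρ p E) =
      entropy (∑ x, (p x : ℂ) • N.map ((E x).map (ptrR ρ))) +
        ∑ x, p x * (entropy (ptrL ρ) - entropy (assistedOut N (E x) ρ)) := by
  have hout := fun x => isState_assistedOut (N := N) hρ (E x)
  have hω : (assistedCQ N ρ p E).PosSemidef := (isState_cqState hp hout).1
  have hX : ptrR ((assistedCQ N ρ p E).submatrix (regroupEquiv (Fin n) B EB)
      (regroupEquiv (Fin n) B EB)) = cqState p fun _ => ptrL ρ := by
    ext ⟨x, e⟩ ⟨x', e'⟩
    have h := congrFun (congrFun (ptrL_assistedOut (N := N) (ρ := ρ) (E x)) e) e'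
    simp only [ptrL, of_apply] at h
    by_cases hx : x = x'
    · subst hx
      simp [ptrR, assistedCQ, cqState, regroupEquiv, ptrL, ← Finset.mul_sum, h]
    · simp [ptrR, assistedCQ, cqState, regroupEquiv, hx]
  have hB : ptrL ((assistedCQ N ρ p E).submatrix (regroupEquiv (Fin n) B EB)
      (regroupEquiv (Fin n) B EB)) = ∑ x, (p x : ℂ) • N.map ((E x).map (ptrR ρ)) := by
    simp_rw [← ptrR_assistedOut]
    rw [← ptrR_sum_smul, ← ptrL_cqState]
    ext b b'
    simp only [ptrL, ptrR, of_apply, submatrix_apply, Fintype.sum_prod_type]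
    exact Finset.sum_comm
  rw [infoXE_B_D, mutualInfoD_eq (hω.submatrix _), hX, hB,
    entropy_submatrix hω.isHermitian, assistedCQ, entropy_cqState hp.1 fun _ => hρ.ptrL,
    entropy_cqState hp.1 hout]
  simp only [mul_sub, Finset.sum_sub_distrib]
  ring

theorem mutualInfoD_assistedCQ_le (hρ : IsState ρ) (hp : IsProbDist p) :
    mutualInfoD (assistedCQ N ρ p E) ≤ infoXE_B_D (assistedCQ N ρ p E) := by
  have hout := fun x => isState_assistedOut (N := N) hρ (E x)
  have h0 := isState_sum hp hout
  have h := mutualInfoD_nonneg h0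
  have hE : ptrL (∑ x, (p x : ℂ) • assistedOut N (E x) ρ) = ptrL ρ := by
    rw [ptrL_sum_smul]
    simp_rw [ptrL_assistedOut]
    rw [← Finset.sum_smul, ← Complex.ofReal_sum, hp.2, Complex.ofReal_one, one_smul]
  rw [mutualInfoD_eq h0.1, hE, ptrR_sum_smul] at h
  simp_rw [ptrR_assistedOut] at h
  rw [infoXE_B_D_assistedCQ hρ hp, assistedCQ, mutualInfoD_cqState hp hout]
  simp only [mul_sub, Finset.sum_sub_distrib, ← Finset.sum_mul, hp.2, one_mul]
  linarith

theorem infoXE_B_D_le_relEnt_pinch (hp : IsProbDist p) {m : ℕ} {q : Fin m → ℝ}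
    {τ : Fin m → Matrix (EA × EB) (EA × EB) ℂ} (hq : IsProbDist q) (hτ : ∀ k, IsState (τ k))
    {V : Fin m → Matrix EB EB ℂ} (hV : ∀ k, (V k)ᴴ * V k = 1) :
    infoXE_B_D (assistedCQ N (∑ k, (q k : ℂ) • τ k) p E) ≤
      holevoD N + ∑ k, q k * relEnt (τ k) (pinch (τ k) (V k)) := by
  choose r σ hr hσ hsum hle using fun k => exists_ensemble (hτ k) (hV k)
  rw [infoXE_B_D_assistedCQ (isState_sum hq hτ) hp]
  have hQ : IsProbDist fun z : Fin n × Fin m × EB => p z.1 * (q z.2.1 * r z.2.1 z.2.2) := by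
    refine ⟨fun z => mul_nonneg (hp.1 _) (mul_nonneg (hq.1 _) ((hr _).1 _)), ?_⟩
    simp only [Fintype.sum_prod_type, ← Finset.mul_sum, (hr _).2, mul_one, hq.2, hp.2]
  have h1 := entropy_sub_le_holevoD N hQ
    (σ := fun z => (E z.1).map (σ z.2.1 z.2.2)) fun z => (E z.1).isState_map (hσ _ _)
  have h2 : ∑ z : Fin n × Fin m × EB, ((p z.1 * (q z.2.1 * r z.2.1 z.2.2) : ℝ) : ℂ) •
      N.map ((E z.1).map (σ z.2.1 z.2.2)) =
      ∑ x, (p x : ℂ) • N.map ((E x).map (ptrR (∑ k, (q k : ℂ) • τ k))) := by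
    simp only [Fintype.sum_prod_type, ptrR_sum_smul, ← hsum, map_sum, map_smul, Finset.smul_sum,
      smul_smul, Complex.ofReal_mul]
  have h3 : ∀ x, entropy (ptrL (∑ k, (q k : ℂ) • τ k)) -
      entropy (assistedOut N (E x) (∑ k, (q k : ℂ) • τ k)) ≤
      ∑ k, q k * relEnt (τ k) (pinch (τ k) (V k)) -
        ∑ k, q k * ∑ y, r k y * entropy (N.map ((E x).map (σ k y))) := by
    intro x
    have hc := condEntropy_concave hq.1
      fun k => (isState_assistedOut (N := N) (hτ k) (E x)).1
    have hm : ∑ k, (q k : ℂ) • assistedOut N (E x) (τ k) =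
        assistedOut N (E x) (∑ k, (q k : ℂ) • τ k) := by
      simp only [assistedOut, map_sum, map_smul]
    rw [hm, ptrL_assistedOut] at hc
    refine hc.trans ?_
    rw [← Finset.sum_sub_distrib]
    refine Finset.sum_le_sum fun k _ => ?_
    rw [← mul_sub, ptrL_assistedOut]
    exact mul_le_mul_of_nonneg_left (hle k (N.comp (E x))) (hq.1 k)
  have h4 := Finset.sum_le_sum fun x (_ : x ∈ Finset.univ) =>
    mul_le_mul_of_nonneg_left (h3 x) (hp.1 x)
  rw [h2] at h1
  simp only [Fintype.sum_prod_type, mul_assoc, ← Finset.mul_sum] at h1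
  have h5 : ∀ (c : ℝ) (f : Fin n → ℝ), ∑ x, p x * (c - f x) = c - ∑ x, p x * f x := by
    intro c f
    simp only [mul_sub, Finset.sum_sub_distrib, ← Finset.sum_mul, hp.2, one_mul]
  rw [h5 _ fun x => ∑ k, q k * ∑ y, r k y * entropy (N.map ((E x).map (σ k y)))] at h4
  linarith

theorem relEntDiscord_nonneg (hρ : IsState ρ) : 0 ≤ relEntDiscord ρ := by
  refine Real.sInf_nonneg ?_
  rintro _ ⟨V, hV, rfl⟩
  exact relEnt_pinch_nonneg hρ.1 (mem_unitaryGroup_iff'.1 hV)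

theorem exists_relEnt_pinch_lt (ρ : Matrix (EA × EB) (EA × EB) ℂ) {ε : ℝ} (hε : 0 < ε) :
    ∃ V : Matrix EB EB ℂ, Vᴴ * V = 1 ∧ relEnt ρ (pinch ρ V) < relEntDiscord ρ + ε := by
  obtain ⟨_, ⟨V, hV, rfl⟩, h⟩ := Real.lt_sInf_add_pos
    (s := { r | ∃ V ∈ Matrix.unitaryGroup EB ℂ, r = relEnt ρ (pinch ρ V) })
    ⟨_, 1, one_mem _, rfl⟩ hε
  exact ⟨V, mem_unitaryGroup_iff'.1 hV, h⟩

theorem infoXE_B_D_le_discordOfFormation (hρ : IsState ρ) (hp : IsProbDist p) :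
    infoXE_B_D (assistedCQ N ρ p E) ≤ holevoD N + discordOfFormation ρ := by
  rw [← sub_le_iff_le_add']
  refine le_csInf ⟨_, 1, fun _ => 1, fun _ => ρ, ⟨by simp, by simp⟩, fun _ => hρ, by simp, rfl⟩ ?_
  rintro _ ⟨m, q, τ, hq, hτ, rfl, rfl⟩
  rw [sub_le_iff_le_add']
  refine le_of_forall_pos_le_add fun ε hε => ?_
  choose V hV hVε using fun k => exists_relEnt_pinch_lt (τ k) hε
  refine (infoXE_B_D_le_relEnt_pinch hp hq hτ hV).trans ?_
  have h := Finset.sum_le_sum fun k (_ : k ∈ Finset.univ) =>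
    mul_le_mul_of_nonneg_left (hVε k).le (hq.1 k)
  simp only [mul_add, Finset.sum_add_distrib, ← Finset.sum_mul, hq.2, one_mul] at h
  linarith

theorem discordOfFormation_nonneg : 0 ≤ discordOfFormation ρ := by
  refine Real.sInf_nonneg ?_
  rintro _ ⟨m, q, τ, hq, hτ, -, rfl⟩
  exact Finset.sum_nonneg fun k _ => mul_nonneg (hq.1 k) (relEntDiscord_nonneg (hτ k))

end Enhancement

/-- the enhancement of the Holevo information by the assistance
state is bounded by the discord of formation:
`χ_ρ(N) - χ(N) ≤ I_ρ(N) - χ(N) ≤ D_F(ρ_{E_AE_B})`. -/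
theorem enhancement_le_discord_of_formation
    {EA EB A B : Type*} [Fintype EA] [DecidableEq EA] [Fintype EB] [DecidableEq EB]
    [Fintype A] [DecidableEq A] [Fintype B] [DecidableEq B]
    (N : QChannel A B) (ρ : Matrix (EA × EB) (EA × EB) ℂ) (hρ : IsState ρ) :
    assistedHolevoD N ρ - holevoD N ≤ assistedMutualD N ρ - holevoD N ∧
    assistedMutualD N ρ - holevoD N ≤ discordOfFormation ρ := by
  constructor
  · refine sub_le_sub_right (Real.sSup_le ?_ (Real.sSup_nonneg ?_)) _
    · rintro _ ⟨n, p, E, hp, rfl⟩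
      refine (mutualInfoD_assistedCQ_le hρ hp).trans (le_csSup ?_ ⟨n, p, E, hp, rfl⟩)
      refine ⟨holevoD N + discordOfFormation ρ, ?_⟩
      rintro _ ⟨n, p, E, hp, rfl⟩
      exact infoXE_B_D_le_discordOfFormation hρ hp
    · rintro _ ⟨n, p, E, hp, rfl⟩
      exact (mutualInfoD_nonneg (isState_cqState hp fun x => isState_assistedOut hρ (E x))).trans
        (mutualInfoD_assistedCQ_le hρ hp)
  · rw [sub_le_iff_le_add']
    refine Real.sSup_le ?_ (add_nonneg (holevoD_nonneg N) discordOfFormation_nonneg)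
    rintro _ ⟨n, p, E, hp, rfl⟩
    exact infoXE_B_D_le_discordOfFormation hρ hp

end QIT
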